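/- arXiv:0801.2662 — 17 statements merged into one kernel-verified Lean document; each statement's English description precedes it below -/
import Mathlib

section
/- Let n be a positive integer and A ⊂ ℕ∖{0} a finite set with |A| = n. Set d = GCD(A) and A' = {a/d : a ∈ A}. Then the polynomials p_a(n) for a ∈ A have no common zero in ℂ^n other than the origin if and only if the polynomials p_a(n) for a ∈ A' have no common zero in ℂ^n other than the origin. -/
/-- Let `n` be a positive integer and `A ⊂ ℕ∖{0}` a finite set with `|A| = n`.
Set `d = GCD(A)` and `A' = {a/d : a ∈ A}`. Then the power sums `p_a(n)`, `a ∈ A`, have no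
common zero in `ℂ^n` other than the origin iff the power sums `p_a(n)`, `a ∈ A'`, have no
common zero in `ℂ^n` other than the origin. -/
theorem stmt0 (n : ℕ) (hn : 0 < n) (A : Finset ℕ) (hA0 : 0 ∉ A) (hcard : A.card = n)
    (d : ℕ) (hd : d = A.gcd id) (A' : Finset ℕ) (hA' : A' = A.image (· / d)) :
    (∀ z : Fin n → ℂ, (∀ a ∈ A, ∑ i, z i ^ a = 0) → z = 0) ↔
      (∀ z : Fin n → ℂ, (∀ a ∈ A', ∑ i, z i ^ a = 0) → z = 0) := by
  have hdvd : ∀ a ∈ A, d ∣ a := fun a ha => hd ▸ Finset.gcd_dvd (f := id) ha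
  have hd0 : d ≠ 0 := by
    obtain ⟨a, ha⟩ := Finset.card_pos.mp (hcard ▸ hn)
    rintro rfl
    exact hA0 (zero_dvd_iff.mp (hdvd a ha) ▸ ha)
  subst hA'
  simp only [Finset.forall_mem_image]
  have hpow : ∀ w : Fin n → ℂ, ∀ a ∈ A, ∑ i, (w i ^ d) ^ (a / d) = ∑ i, w i ^ a :=
    fun w a ha => by simp only [← pow_mul, Nat.mul_div_cancel' (hdvd a ha)]
  constructor
  · intro h z hz
    choose w hw using fun i => IsAlgClosed.exists_pow_nat_eq (z i) (Nat.pos_of_ne_zero hd0)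
    have hw0 : w = 0 := h w fun a ha => by
      rw [← hpow w a ha]
      simpa only [hw] using hz ha
    funext i
    simp [← hw i, hw0, hd0]
  · intro h z hz
    have hzd : (fun i => z i ^ d) = 0 := h _ fun a ha => (hpow z a ha).trans (hz a ha)
    funext i
    exact eq_zero_of_pow_eq_zero (congrFun hzd i)
end

section
/- Let A ⊂ ℕ∖{0} be a finite nonempty set, d = GCD(A), and A' = {a/d : a ∈ A}. Then the equations p_a(2) = 0, a ∈ A, have a common zero in ℂ^2 different from (0,0) if and only if every element of A' is odd. -/
/-- Let `A ⊂ ℕ∖{0}` be a finite nonempty set, `d = GCD(A)`, and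
`A' = {a/d : a ∈ A}`. Then the equations `p_a(2) = 0`, `a ∈ A`, have a common zero
in `ℂ²` different from `(0,0)` iff every element of `A'` is odd. -/
theorem stmt1 (A : Finset ℕ) (hA0 : 0 ∉ A) (hne : A.Nonempty)
    (d : ℕ) (hd : d = A.gcd id) (A' : Finset ℕ) (hA' : A' = A.image (· / d)) :
    (∃ z : ℂ × ℂ, z ≠ 0 ∧ ∀ a ∈ A, z.1 ^ a + z.2 ^ a = 0) ↔ ∀ a ∈ A', Odd a := by
  subst hA' hd
  have hdvd : ∀ a ∈ A, A.gcd id * (a / A.gcd id) = a := fun a ha =>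
    Nat.mul_div_cancel' (Finset.gcd_dvd (f := id) ha)
  obtain ⟨b, hb⟩ := hne
  have hpos : ∀ a ∈ A, a ≠ 0 := fun a ha h => hA0 (h ▸ ha)
  simp only [Finset.forall_mem_image]
  constructor
  · rintro ⟨⟨x, y⟩, hz, h⟩ a ha
    simp only at h
    have hy : y ≠ 0 := by
      rintro rfl
      have hx := h b hb
      rw [zero_pow (hpos b hb), add_zero] at hx
      exact hz (by simp [eq_zero_of_pow_eq_zero hx])
    have ht : ∀ c ∈ A, (x / y) ^ c = -1 := fun c hc => by
      rw [div_pow, div_eq_iff (pow_ne_zero c hy)]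
      linear_combination h c hc
    have h2d : orderOf (x / y) ∣ 2 * A.gcd id := by
      have := Finset.dvd_gcd (s := A) (f := fun c => 2 * id c) (a := orderOf (x / y))
        fun c hc => orderOf_dvd_of_pow_eq_one (by
          rw [id, mul_comm, pow_mul, ht c hc]
          norm_num)
      rwa [Finset.gcd_mul_left, normalize_eq] at this
    have hsq : ((x / y) ^ A.gcd id) ^ 2 = 1 := by
      rw [← pow_mul, mul_comm]
      exact orderOf_dvd_iff_pow_eq_one.mp h2d
    have hta := ht a ha
    rw [← hdvd a ha, pow_mul] at hta
    rcases sq_eq_one_iff.mp hsq with h1 | h1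
    · norm_num [h1] at hta
    · rw [h1] at hta
      exact (neg_one_pow_eq_neg_one_iff_odd (by norm_num)).mp hta
  · intro h
    have hd0 : 0 < A.gcd id :=
      Nat.pos_of_dvd_of_pos (Finset.gcd_dvd (f := id) hb) (Nat.pos_of_ne_zero (hpos b hb))
    obtain ⟨t, ht⟩ := IsAlgClosed.exists_pow_nat_eq (-1 : ℂ) hd0
    refine ⟨(t, 1), by simp, fun a ha => ?_⟩
    have hta : t ^ a = -1 := by
      rw [← hdvd a ha, pow_mul, ht, (h ha).neg_one_pow]
    simp [hta]
end

section
/- Let A ⊂ ℕ∖{0} be a finite nonempty set. Then the equations h_a(2) = 0, a ∈ A, have a common zero in ℂ^2 different from (0,0) if and only if GCD({a+1 : a ∈ A}) > 1. -/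
/-- A zero of the homogeneous geometric sum of degree `a`, other than the origin, has nonzero
second coordinate. -/
theorem snd_ne_zero_of_geom_sum₂_eq_zero {K : Type*} [Field K] {x y : K} (hxy : (x, y) ≠ 0) {a : ℕ}
    (h : ∑ i ∈ Finset.range (a + 1), x ^ i * y ^ (a - i) = 0) : y ≠ 0 := by
  rintro rfl
  rw [Finset.sum_range_succ, Finset.sum_eq_zero fun i hi => by
    rw [zero_pow (by have := Finset.mem_range.mp hi; omega), mul_zero]] at h
  simp only [tsub_self, pow_zero, mul_one, zero_add] at h
  exact hxy (by simp [eq_zero_of_pow_eq_zero h])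

/-- For `y ≠ 0` in a field of characteristic zero, the homogeneous geometric sum of degree `a`
vanishes at `(x, y)` iff `x / y` is an `(a + 1)`-st root of unity other than `1`. -/
theorem geom_sum₂_eq_zero_iff {K : Type*} [Field K] [CharZero K] {x y : K} (hy : y ≠ 0) (a : ℕ) :
    ∑ i ∈ Finset.range (a + 1), x ^ i * y ^ (a - i) = 0 ↔
      x / y ≠ 1 ∧ (x / y) ^ (a + 1) = 1 := by
  have hgeom : (∑ i ∈ Finset.range (a + 1), x ^ i * y ^ (a - i)) * (x - y)
      = x ^ (a + 1) - y ^ (a + 1) := by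
    simpa using (Commute.all x y).geom_sum₂_mul (a + 1)
  rw [div_pow, div_eq_one_iff_eq (pow_ne_zero _ hy), Ne, div_eq_one_iff_eq hy]
  constructor
  · intro h
    refine ⟨?_, ?_⟩
    · rintro rfl
      rw [Finset.sum_congr rfl fun i hi => by
        rw [← pow_add, Nat.add_sub_cancel' (Nat.lt_succ_iff.mp (Finset.mem_range.mp hi))]] at h
      simp only [Finset.sum_const, Finset.card_range, nsmul_eq_mul] at h
      exact mul_ne_zero (Nat.cast_ne_zero.mpr a.succ_ne_zero) (pow_ne_zero _ hy) h
    · rwa [h, zero_mul, eq_comm, sub_eq_zero] at hgeom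
  · rintro ⟨hne, hpow⟩
    rw [hpow, sub_self] at hgeom
    exact (mul_eq_zero.mp hgeom).resolve_right (sub_ne_zero.mpr hne)

/-- Let `A ⊂ ℕ∖{0}` be a finite nonempty set. Then the equations
`h_a(2) = 0`, `a ∈ A`, have a common zero in `ℂ²` different from `(0,0)` iff
`GCD({a+1 : a ∈ A}) > 1`. Here `h_a(2)` evaluated at `(x,y)` is
`∑_{i=0}^{a} x^i y^{a-i}`. -/
theorem stmt2 (A : Finset ℕ) (hA0 : 0 ∉ A) (hne : A.Nonempty) :
    (∃ z : ℂ × ℂ, z ≠ 0 ∧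
        ∀ a ∈ A, ∑ i ∈ Finset.range (a + 1), z.1 ^ i * z.2 ^ (a - i) = 0) ↔
      1 < A.gcd (· + 1) := by
  obtain ⟨b, hb⟩ := hne
  have hgcd : A.gcd (· + 1) ≠ 0 := fun h => b.succ_ne_zero (Finset.gcd_eq_zero_iff.mp h b hb)
  constructor
  · rintro ⟨⟨x, y⟩, hz, h⟩
    have hy : y ≠ 0 := snd_ne_zero_of_geom_sum₂_eq_zero hz (h b hb)
    have hroot a (ha : a ∈ A) := (geom_sum₂_eq_zero_iff hy a).mp (h a ha)
    have hdvd : orderOf (x / y) ∣ A.gcd (· + 1) :=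
      Finset.dvd_gcd fun a ha => orderOf_dvd_of_pow_eq_one (hroot a ha).2
    refine (Nat.one_lt_iff_ne_zero_and_ne_one).mpr ⟨hgcd, fun h1 => (hroot b hb).1 ?_⟩
    rwa [h1, Nat.dvd_one, orderOf_eq_one_iff] at hdvd
  · intro h
    obtain ⟨ζ, hζ⟩ : ∃ ζ : ℂ, IsPrimitiveRoot ζ (A.gcd (· + 1)) :=
      ⟨_, Complex.isPrimitiveRoot_exp _ hgcd⟩
    refine ⟨(ζ, 1), by simp, fun a ha => (geom_sum₂_eq_zero_iff one_ne_zero a).mpr ?_⟩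
    rw [div_one]
    exact ⟨hζ.ne_one h, (hζ.pow_eq_one_iff_dvd _).mpr (Finset.gcd_dvd ha)⟩
end

section
/- Let a, b be positive integers and d = GCD(a,b). Then the pair (p_a(2), p_b(2)) has no common zero in ℂ^2 other than (0,0) if and only if a/d is even or b/d is even. -/
/-- If `m` is even, `n` is odd and `a * n = b * m`, then `p_a(2)` and `p_b(2)` have only the
trivial common zero. -/
lemma eq_zero_of_pow_add_pow_eq_zero {a b m n : ℕ} (ha : 0 < a) (hm : Even m) (hn : Odd n)
    (h : a * n = b * m) {x y : ℂ} (hxa : x ^ a + y ^ a = 0) (hxb : x ^ b + y ^ b = 0) :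
    x = 0 ∧ y = 0 := by
  have h₁ : x ^ (a * n) = -y ^ (a * n) := by
    rw [pow_mul, pow_mul, eq_neg_of_add_eq_zero_left hxa, hn.neg_pow]
  have h₂ : x ^ (a * n) = y ^ (a * n) := by
    rw [h, pow_mul, pow_mul, eq_neg_of_add_eq_zero_left hxb, hm.neg_pow]
  have hy : y = 0 := eq_zero_of_pow_eq_zero (self_eq_neg.mp (h₂.symm.trans h₁))
  subst hy
  rw [zero_pow ha.ne', add_zero] at hxa
  exact ⟨eq_zero_of_pow_eq_zero hxa, rfl⟩

/-- Let `a, b` be positive integers and `d = GCD(a,b)`. Then the pair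
`(p_a(2), p_b(2))` has no common zero in `ℂ²` other than `(0,0)` iff `a/d` is even or
`b/d` is even. -/
theorem stmt3 (a b : ℕ) (ha : 0 < a) (hb : 0 < b) (d : ℕ) (hd : d = Nat.gcd a b) :
    (∀ z : ℂ × ℂ, z.1 ^ a + z.2 ^ a = 0 → z.1 ^ b + z.2 ^ b = 0 → z = 0) ↔
      Even (a / d) ∨ Even (b / d) := by
  have hd0 : 0 < d := hd ▸ Nat.gcd_pos_of_pos_left b ha
  have hcop : Nat.Coprime (a / d) (b / d) := by
    subst hd
    exact Nat.coprime_div_gcd_div_gcd hd0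
  have hda : d * (a / d) = a := Nat.mul_div_cancel' (hd ▸ Nat.gcd_dvd_left a b)
  have hdb : d * (b / d) = b := Nat.mul_div_cancel' (hd ▸ Nat.gcd_dvd_right a b)
  generalize a / d = m at *
  generalize b / d = n at *
  subst hda hdb
  constructor
  · intro h
    by_contra! hodd
    simp only [Nat.not_even_iff_odd] at hodd
    obtain ⟨w, hw⟩ := IsAlgClosed.exists_pow_nat_eq (-1 : ℂ) hd0
    have hz := h (w, 1) (by simp [pow_mul, hw, hodd.1.neg_one_pow])
      (by simp [pow_mul, hw, hodd.2.neg_one_pow])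
    simp at hz
  · rintro (hm | hn) ⟨x, y⟩ hxa hxb
    · have hn : Odd n := by
        by_contra hn
        exact Nat.not_coprime_of_dvd_of_dvd one_lt_two hm.two_dvd
          (Nat.not_odd_iff_even.mp hn).two_dvd hcop
      exact Prod.ext_iff.mpr (eq_zero_of_pow_add_pow_eq_zero ha hm hn (by ring) hxa hxb)
    · have hm : Odd m := by
        by_contra hm
        exact Nat.not_coprime_of_dvd_of_dvd one_lt_two
          (Nat.not_odd_iff_even.mp hm).two_dvd hn.two_dvd hcop
      exact Prod.ext_iff.mpr (eq_zero_of_pow_add_pow_eq_zero hb hn hm (by ring) hxb hxa)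
end

section
/- Let a, b be positive integers. Then the pair (h_a(2), h_b(2)) has no common zero in ℂ^2 other than (0,0) if and only if GCD(a+1, b+1) = 1. -/
theorem pow_eq_pow_of_geom_sum_eq_zero {R : Type*} [CommRing R] {x y : R} {n : ℕ}
    (h : ∑ i ∈ Finset.range (n + 1), x ^ i * y ^ (n - i) = 0) : x ^ (n + 1) = y ^ (n + 1) := by
  have key := (Commute.all x y).geom_sum₂_mul (n + 1)
  rw [Nat.add_sub_cancel, h, zero_mul] at key
  exact (sub_eq_zero.mp key.symm)

theorem geom_sum_one_eq_zero {R : Type*} [CommRing R] [IsDomain R] {x : R} {n : ℕ}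
    (hx : x ≠ 1) (h : x ^ (n + 1) = 1) :
    ∑ i ∈ Finset.range (n + 1), x ^ i * (1 : R) ^ (n - i) = 0 := by
  have key := (Commute.all x 1).geom_sum₂_mul (n + 1)
  rw [Nat.add_sub_cancel, h, one_pow, sub_self] at key
  exact (mul_eq_zero.mp key).resolve_right (sub_ne_zero.mpr hx)

/-- Let `a, b` be positive integers. Then the pair `(h_a(2), h_b(2))` has no
common zero in `ℂ²` other than `(0,0)` iff `GCD(a+1, b+1) = 1`. Here `h_a(2)` evaluated at
`(x,y)` is `∑_{i=0}^{a} x^i y^{a-i}`. -/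
theorem stmt4 (a b : ℕ) (ha : 0 < a) (hb : 0 < b) :
    (∀ z : ℂ × ℂ, ∑ i ∈ Finset.range (a + 1), z.1 ^ i * z.2 ^ (a - i) = 0 →
        ∑ i ∈ Finset.range (b + 1), z.1 ^ i * z.2 ^ (b - i) = 0 → z = 0) ↔
      Nat.gcd (a + 1) (b + 1) = 1 := by
  constructor
  · intro h
    by_contra hg
    have hζ := Complex.isPrimitiveRoot_exp (Nat.gcd (a + 1) (b + 1))
      (Nat.gcd_pos_of_pos_left _ a.succ_pos).ne'
    generalize Complex.exp _ = ζ at hζ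
    have hne : ζ ≠ 1 := fun h1 => hg (Nat.dvd_one.mp (hζ.dvd_of_pow_eq_one 1 (by simp [h1])))
    have hz := h (ζ, 1)
      (geom_sum_one_eq_zero hne ((hζ.pow_eq_one_iff_dvd _).mpr (Nat.gcd_dvd_left _ _)))
      (geom_sum_one_eq_zero hne ((hζ.pow_eq_one_iff_dvd _).mpr (Nat.gcd_dvd_right _ _)))
    exact one_ne_zero (congrArg Prod.snd hz)
  · rintro hg ⟨x, y⟩ h₁ h₂
    dsimp only at h₁ h₂
    have hx := pow_eq_pow_of_geom_sum_eq_zero h₁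
    have hx' := pow_eq_pow_of_geom_sum_eq_zero h₂
    by_cases hy : y = 0
    · subst hy
      rw [zero_pow a.succ_ne_zero] at hx
      exact Prod.ext (eq_zero_of_pow_eq_zero hx) rfl
    · have hw : (x / y) ^ Nat.gcd (a + 1) (b + 1) = 1 :=
        pow_gcd_eq_one.mpr ⟨by rw [div_pow, hx, div_self (pow_ne_zero _ hy)],
          by rw [div_pow, hx', div_self (pow_ne_zero _ hy)]⟩
      rw [hg, pow_one, div_eq_one_iff_eq hy] at hw
      subst hw
      have hsum := (geom_sum₂_self x (a + 1)).symm.trans h₁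
      exact absurd hsum (mul_ne_zero (Nat.cast_ne_zero.mpr a.succ_ne_zero) (pow_ne_zero _ hy))
end

section
/- Let n be a positive integer, A ⊂ ℕ∖{0} with |A| = n, and let c be an integer with 1 ≤ c ≤ n. Set β_c = |{a ∈ A : c divides a}|. If β_c < ⌊n/c⌋, then the polynomials p_a(n), a ∈ A, have a common zero in ℂ^n different from the origin (i.e., p_A(n) is not a regular sequence). -/
namespace MvPolynomial

/-- The substitution sending the first `k` variables to `0` and fixing the others. -/
noncomputable def killVars (K : Type*) [CommRing K] (q k : ℕ) :
    MvPolynomial (Fin q) K →ₐ[K] MvPolynomial (Fin q) K :=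
  aeval fun i => if (i : ℕ) < k then 0 else X i

theorem killVars_X {K : Type*} [CommRing K] {q : ℕ} (k : ℕ) (i : Fin q) :
    killVars K q k (X i) = if (i : ℕ) < k then 0 else X i := by
  simp [killVars]

theorem killVars_succ_comp (K : Type*) [CommRing K] (q k : ℕ) :
    (killVars K q (k + 1)).comp (killVars K q k) = killVars K q (k + 1) := by
  ext1 i
  rw [AlgHom.comp_apply, killVars_X]
  split_ifs with h
  · rw [map_zero, killVars_X, if_pos (by omega)]
  · rfl

theorem le_height_ker_killVars {K : Type*} [CommRing K] [IsDomain K] {q k : ℕ} (hk : k ≤ q) :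
    (k : ℕ∞) ≤ (RingHom.ker (killVars K q k)).height := by
  induction k with
  | zero => simp
  | succ k ih =>
    have : (RingHom.ker (killVars K q k)).IsPrime := RingHom.ker_isPrime _
    have : (RingHom.ker (killVars K q (k + 1))).IsPrime := RingHom.ker_isPrime _
    have hlt : RingHom.ker (killVars K q k) < RingHom.ker (killVars K q (k + 1)) := by
      refine SetLike.lt_iff_le_and_exists.2 ⟨fun p hp => ?_, X ⟨k, hk⟩, ?_, ?_⟩
      · rw [RingHom.mem_ker] at hp ⊢
        rw [← killVars_succ_comp, AlgHom.comp_apply, hp, map_zero]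
      · simp [RingHom.mem_ker, killVars_X]
      · simp [RingHom.mem_ker, killVars_X]
    push_cast
    exact (add_le_add_left (ih (by omega)) 1).trans
      (Ideal.height_add_one_le_of_lt_of_isPrime hlt)

theorem le_height_vanishingIdeal_zero (K : Type*) [Field K] (q : ℕ) :
    (q : ℕ∞) ≤ (vanishingIdeal K {(0 : Fin q → K)}).height := by
  refine (le_height_ker_killVars (K := K) le_rfl).trans (Ideal.height_mono fun p hp => ?_)
  rw [mem_vanishingIdeal_singleton_iff]
  have h : (aeval (0 : Fin q → K)).comp (killVars K q q) = aeval (0 : Fin q → K) := by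
    ext i
    simp [killVars_X]
  rw [← h, AlgHom.comp_apply, RingHom.mem_ker.1 hp, map_zero]

/-- Fewer than `q` polynomials in `q` variables that vanish at the origin have another
common zero. -/
theorem exists_ne_zero_forall_aeval_eq_zero {K : Type*} [Field K] [IsAlgClosed K] {q : ℕ}
    (s : Finset (MvPolynomial (Fin q) K)) (hs : s.card < q)
    (h0 : ∀ p ∈ s, aeval (0 : Fin q → K) p = 0) :
    ∃ x : Fin q → K, x ≠ 0 ∧ ∀ p ∈ s, aeval x p = 0 := by
  by_contra! H
  have hz : zeroLocus K (Ideal.span (s : Set (MvPolynomial (Fin q) K))) = {0} := by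
    rw [zeroLocus_span]
    ext x
    simp only [Finset.mem_coe, Set.mem_ofPred_eq, Set.mem_singleton_iff]
    constructor
    · intro hx
      by_contra hne
      obtain ⟨p, hp, hp'⟩ := H x hne
      exact hp' (hx p hp)
    · rintro rfl
      exact h0
  have hrad := vanishingIdeal_zeroLocus_eq_radical (k := K) (K := K)
    (Ideal.span (s : Set (MvPolynomial (Fin q) K)))
  rw [hz] at hrad
  have hmin : vanishingIdeal K {(0 : Fin q → K)} ∈
      (Ideal.span (s : Set (MvPolynomial (Fin q) K))).minimalPrimes := by
    refine ⟨⟨inferInstance, hrad ▸ Ideal.le_radical⟩, fun J hJ _ => ?_⟩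
    rw [hrad]
    exact hJ.1.radical_le_iff.2 hJ.2
  have hle := (le_height_vanishingIdeal_zero K q).trans
    (Ideal.height_le_card_of_mem_minimalPrimes_span_finset hmin)
  exact absurd (Nat.cast_le.1 hle) (by omega)

end MvPolynomial

theorem Finset.sum_range_mul_div_mod {M : Type*} [AddCommMonoid M] (c : ℕ) (hc : 0 < c)
    (f : ℕ → ℕ → M) (q : ℕ) :
    ∑ i ∈ Finset.range (c * q), f (i / c) (i % c) =
      ∑ k ∈ Finset.range q, ∑ j ∈ Finset.range c, f k j := by
  induction q with
  | zero => simp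
  | succ q ih =>
    rw [Nat.mul_succ, Finset.sum_range_add, ih, Finset.sum_range_succ]
    congr 1
    refine Finset.sum_congr rfl fun j hj => ?_
    have hj := Finset.mem_range.1 hj
    rw [Nat.mul_add_div hc, Nat.div_eq_of_lt hj, Nat.mul_add_mod, Nat.mod_eq_of_lt hj, add_zero]

theorem IsPrimitiveRoot.sum_range_pow_pow_eq_zero {R : Type*} [CommRing R] [IsDomain R]
    {ζ : R} {c a : ℕ} (hζ : IsPrimitiveRoot ζ c) (h : ¬ c ∣ a) :
    ∑ j ∈ Finset.range c, (ζ ^ j) ^ a = 0 := by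
  have hne : 1 - ζ ^ a ≠ 0 := fun h1 => h (hζ.dvd_of_pow_eq_one a (sub_eq_zero.1 h1).symm)
  have hg := mul_neg_geom_sum (ζ ^ a) c
  rw [← pow_mul, mul_comm a c, pow_mul, hζ.pow_eq_one, one_pow, sub_self] at hg
  simpa only [← pow_mul, mul_comm] using (mul_eq_zero.1 hg).resolve_left hne

/-- Let `n` be a positive integer, `A ⊂ ℕ∖{0}` with `|A| = n`, and let `c` be an
integer with `1 ≤ c ≤ n`. Set `β_c = |{a ∈ A : c ∣ a}|`. If `β_c < ⌊n/c⌋`, then the power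
sums `p_a(n)`, `a ∈ A`, have a common zero in `ℂ^n` different from the origin. -/
theorem stmt6 (n : ℕ) (hn : 0 < n) (A : Finset ℕ) (hA0 : 0 ∉ A) (hcard : A.card = n)
    (c : ℕ) (hc1 : 1 ≤ c) (hcn : c ≤ n)
    (hβ : (A.filter (fun a => c ∣ a)).card < n / c) :
    ∃ z : Fin n → ℂ, z ≠ 0 ∧ ∀ a ∈ A, ∑ i, z i ^ a = 0 := by
  classical
  set q := n / c with hq
  have hcq : c * q ≤ n := Nat.mul_div_le n c
  have ha0 : ∀ a ∈ A, a ≠ 0 := fun a ha h => hA0 (h ▸ ha)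
  obtain ⟨y, hy0, hy⟩ := MvPolynomial.exists_ne_zero_forall_aeval_eq_zero
    ((A.filter (fun a => c ∣ a)).image fun a => MvPolynomial.psum (Fin q) ℂ a)
    (Finset.card_image_le.trans_lt hβ) (by
      simp only [Finset.mem_image, Finset.mem_filter]
      rintro _ ⟨a, ⟨ha, -⟩, rfl⟩
      simp [MvPolynomial.psum, ha0 a ha])
  let Y : ℕ → ℂ := fun k => if h : k < q then y ⟨k, h⟩ else 0
  let ζ : ℂ := Complex.exp (2 * Real.pi * Complex.I / c)
  have hζ : IsPrimitiveRoot ζ c := Complex.isPrimitiveRoot_exp c (by omega)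
  refine ⟨fun i => Y (i / c) * ζ ^ ((i : ℕ) % c), fun hz => ?_, fun a ha => ?_⟩
  · refine hy0 (funext fun k => ?_)
    have hk : c * (k : ℕ) < n :=
      (Nat.mul_lt_mul_of_pos_left k.2 hc1).trans_le hcq
    have := congrFun hz ⟨c * k, hk⟩
    simpa [Y, Nat.mul_div_cancel_left _ hc1] using this
  · rw [Fin.sum_univ_eq_sum_range (fun i => (Y (i / c) * ζ ^ (i % c)) ^ a) n,
      ← Finset.sum_subset (Finset.range_mono hcq) fun i _ hi => ?_,
      Finset.sum_range_mul_div_mod c hc1 (fun k j => (Y k * ζ ^ j) ^ a)]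
    · simp only [mul_pow, ← Finset.mul_sum, ← Finset.sum_mul]
      by_cases hca : c ∣ a
      · have h := hy _ (Finset.mem_image_of_mem _ (Finset.mem_filter.2 ⟨ha, hca⟩))
        simp only [MvPolynomial.psum, map_sum, map_pow, MvPolynomial.aeval_X] at h
        rw [← Fin.sum_univ_eq_sum_range (fun k => Y k ^ a) q]
        simp [Y, h]
      · rw [hζ.sum_range_pow_pow_eq_zero hca, mul_zero]
    · have hi : ¬ i / c < q := fun h => hi <| Finset.mem_range.2 <| by
        rw [mul_comm]
        exact (Nat.div_lt_iff_lt_mul hc1).1 h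
      simp [Y, hi, ha0 a ha]
end

section
/- Let c > 2 be an integer and a a positive integer with a + 2 ≡ 0 (mod c) or a + 2 ≡ 1 (mod c). Let u_1, u_2, u_3 ∈ ℂ be three pairwise distinct c-th roots of unity. Then for every n ≥ 3, the point (u_1, u_2, u_3, 0, …, 0) ∈ ℂ^n is a zero of the complete homogeneous symmetric polynomial h_a(n). -/
/-- Splitting off the first variable in the complete homogeneous symmetric polynomial. -/
theorem sum_antidiagonalTuple_succ_prod_pow {R : Type*} [CommSemiring R] {k : ℕ}
    (x : Fin (k + 1) → R) (a : ℕ) :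
    ∑ d ∈ Finset.Nat.antidiagonalTuple (k + 1) a, ∏ i, x i ^ d i =
      ∑ p ∈ Finset.HasAntidiagonal.antidiagonal a, x 0 ^ p.1 *
        ∑ d ∈ Finset.Nat.antidiagonalTuple k p.2, ∏ i, x i.succ ^ d i := by
  simp_rw [Finset.mul_sum]
  rw [Finset.sum_sigma']
  symm
  refine Finset.sum_bij' (fun q _ => Fin.cons q.1.1 q.2)
    (fun d _ => ⟨(d 0, ∑ i : Fin k, d i.succ), fun i => d i.succ⟩) ?_ ?_ ?_ ?_ ?_
  · rintro ⟨⟨i, j⟩, d⟩ h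
    simp only [Finset.mem_sigma, Finset.HasAntidiagonal.mem_antidiagonal,
      Finset.Nat.mem_antidiagonalTuple] at h
    simp [Finset.Nat.mem_antidiagonalTuple, Fin.sum_univ_succ, h.2, h.1]
  · intro d h
    simpa [Finset.Nat.mem_antidiagonalTuple, Fin.sum_univ_succ] using h
  · rintro ⟨⟨i, j⟩, d⟩ h
    simp only [Finset.mem_sigma, Finset.HasAntidiagonal.mem_antidiagonal,
      Finset.Nat.mem_antidiagonalTuple] at h
    simp [h.2]
  · intro d h
    exact Fin.cons_self_tail d
  · rintro ⟨⟨i, j⟩, d⟩ h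
    simp [Fin.prod_univ_succ]

theorem sum_antidiagonalTuple_prod_zero_pow {R : Type*} [CommSemiring R] (k a : ℕ) :
    ∑ d ∈ Finset.Nat.antidiagonalTuple k a, ∏ i, (0 : R) ^ d i = if a = 0 then 1 else 0 := by
  induction k generalizing a with
  | zero => cases a <;> simp
  | succ k ih =>
    rw [sum_antidiagonalTuple_succ_prod_pow (fun _ => (0 : R))]
    simp_rw [ih]
    cases a <;> simp [Finset.Nat.sum_antidiagonal_succ]

theorem sum_antidiagonal_succ_pow_mul {R : Type*} [CommSemiring R] (x : R) (f : ℕ → R)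
    (a : ℕ) :
    ∑ p ∈ Finset.HasAntidiagonal.antidiagonal (a + 1), x ^ p.1 * f p.2 =
      f (a + 1) + x * ∑ p ∈ Finset.HasAntidiagonal.antidiagonal a, x ^ p.1 * f p.2 := by
  simp [Finset.Nat.sum_antidiagonal_succ, Finset.mul_sum, pow_succ', mul_assoc]

theorem sum_antidiagonal_pow_mul_ite {R : Type*} [CommSemiring R] (x : R) (a : ℕ) :
    ∑ p ∈ Finset.HasAntidiagonal.antidiagonal a, x ^ p.1 * (if p.2 = 0 then 1 else 0) = x ^ a := by
  induction a with
  | zero => simp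
  | succ a ih =>
    rw [sum_antidiagonal_succ_pow_mul x (fun j => if j = 0 then 1 else 0), ih]
    simp [pow_succ']

theorem sub_mul_sum_antidiagonal_pow_mul_pow {R : Type*} [CommRing R] (x y : R) (a : ℕ) :
    (x - y) * ∑ p ∈ Finset.HasAntidiagonal.antidiagonal a, x ^ p.1 * y ^ p.2 =
      x ^ (a + 1) - y ^ (a + 1) := by
  induction a with
  | zero => simp
  | succ a ih =>
    rw [sum_antidiagonal_succ_pow_mul x (y ^ ·)]
    linear_combination x * ih

/-- The bialternant formula for the complete homogeneous symmetric polynomials in three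
variables. -/
theorem vandermonde_mul_sum_antidiagonal {R : Type*} [CommRing R] (x y z : R) (a : ℕ) :
    (x - y) * (x - z) * (y - z) * ∑ p ∈ Finset.HasAntidiagonal.antidiagonal a, x ^ p.1 *
      ∑ q ∈ Finset.HasAntidiagonal.antidiagonal p.2, y ^ q.1 * z ^ q.2 =
    x ^ (a + 2) * (y - z) - y ^ (a + 2) * (x - z) + z ^ (a + 2) * (x - y) := by
  induction a with
  | zero => simp; ring
  | succ a ih =>
    rw [sum_antidiagonal_succ_pow_mul x
      (fun j => ∑ q ∈ Finset.HasAntidiagonal.antidiagonal j, y ^ q.1 * z ^ q.2)]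
    linear_combination x * ih +
      (x - y) * (x - z) * sub_mul_sum_antidiagonal_pow_mul_pow y z (a + 1)

/-- Let `c > 2` be an integer and `a` a positive integer with
`a + 2 ≡ 0 (mod c)` or `a + 2 ≡ 1 (mod c)`. Let `u₁, u₂, u₃ ∈ ℂ` be three pairwise
distinct `c`-th roots of unity. Then for every `n ≥ 3`, the point
`(u₁, u₂, u₃, 0, …, 0) ∈ ℂ^n` is a zero of the complete homogeneous symmetric
polynomial `h_a(n)`, whose value at `z` is `∑_{d₁+⋯+d_n = a} ∏ z_i^{d_i}`. -/
theorem stmt7 (c a : ℕ) (hc : 2 < c) (ha : 0 < a)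
    (hmod : (a + 2) % c = 0 ∨ (a + 2) % c = 1)
    (u₁ u₂ u₃ : ℂ) (hu₁ : u₁ ^ c = 1) (hu₂ : u₂ ^ c = 1) (hu₃ : u₃ ^ c = 1)
    (h12 : u₁ ≠ u₂) (h13 : u₁ ≠ u₃) (h23 : u₂ ≠ u₃) :
    ∀ n : ℕ, 3 ≤ n →
      ∑ d ∈ Finset.Nat.antidiagonalTuple n a,
        ∏ i : Fin n,
          (if (i : ℕ) = 0 then u₁ else if (i : ℕ) = 1 then u₂
            else if (i : ℕ) = 2 then u₃ else 0) ^ d i = 0 := by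
  intro n hn
  obtain ⟨m, rfl⟩ := Nat.exists_eq_add_of_le' hn
  have hV : (u₁ - u₂) * (u₁ - u₃) * (u₂ - u₃) ≠ 0 :=
    mul_ne_zero (mul_ne_zero (sub_ne_zero.2 h12) (sub_ne_zero.2 h13)) (sub_ne_zero.2 h23)
  simp only [sum_antidiagonalTuple_succ_prod_pow, Fin.val_succ, Fin.val_zero, Nat.add_eq_zero_iff,
    Nat.reduceEqDiff, Nat.add_eq_right, one_ne_zero, and_false, if_true, if_false,
    sum_antidiagonalTuple_prod_zero_pow, sum_antidiagonal_pow_mul_ite]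
  refine (mul_eq_zero.1 ?_).resolve_left hV
  rw [vandermonde_mul_sum_antidiagonal, pow_eq_pow_mod _ hu₁,
    pow_eq_pow_mod _ hu₂, pow_eq_pow_mod _ hu₃]
  rcases hmod with h | h <;> rw [h] <;> ring
end

section
/- Let f_1, f_2, …, f_n be homogeneous symmetric polynomials in ℂ[x_1,…,x_n], each of positive degree, whose only common zero in ℂ^n is the origin (equivalently, f_1,…,f_n is a regular sequence). Then n! divides the product (deg f_1)(deg f_2)⋯(deg f_n). -/
open MvPolynomial

theorem MvPolynomial.IsHomogeneous.homogeneousComponent_mul {σ R : Type*} [CommSemiring R]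
    {f : MvPolynomial σ R} {d : ℕ} (hf : f.IsHomogeneous d) (p : MvPolynomial σ R) (k : ℕ) :
    homogeneousComponent k (f * p) = if d ≤ k then f * homogeneousComponent (k - d) p else 0 := by
  classical
  have key (j : ℕ) : homogeneousComponent k (f * homogeneousComponent j p) =
      if d + j = k then f * homogeneousComponent j p else 0 := by
    rw [homogeneousComponent_of_mem (n := d + j)]
    · simp only [eq_comm]
    · exact hf.mul (homogeneousComponent_isHomogeneous j p)
  conv_lhs => rw [← sum_homogeneousComponent p, Finset.mul_sum, map_sum]
  simp_rw [key]
  split_ifs with h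
  · by_cases hk : k - d ∈ Finset.range (p.totalDegree + 1)
    · rw [Finset.sum_eq_single_of_mem _ hk, if_pos (by omega)]
      intro j _ hj
      rw [if_neg (by omega)]
    · rw [homogeneousComponent_eq_zero _ _ (by simp at hk; omega), mul_zero]
      refine Finset.sum_eq_zero fun j hj => if_neg ?_
      rintro rfl
      exact hk (by simpa using hj)
  · exact Finset.sum_eq_zero fun j _ => if_neg (by omega)

theorem Submodule.finrank_map_add_finrank_inf_ker {K V W : Type*} [DivisionRing K] [AddCommGroup V]
    [Module K V] [AddCommGroup W] [Module K W] (φ : V →ₗ[K] W) (U : Submodule K V)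
    [FiniteDimensional K U] :
    Module.finrank K (U.map φ) + Module.finrank K (U ⊓ LinearMap.ker φ : Submodule K V) =
      Module.finrank K U := by
  rw [← (φ.domRestrict U).finrank_range_add_finrank_ker, LinearMap.range_domRestrict,
    LinearMap.ker_domRestrict, ← Submodule.map_comap_subtype, Submodule.finrank_map_subtype_eq]

namespace GradedHilbert

variable {σ K : Type*} [Field K]

/-- A subspace of a polynomial ring is graded if it contains the homogeneous components of
its elements. -/
def IsGraded (L : Submodule K (MvPolynomial σ K)) : Prop :=
  ∀ x ∈ L, ∀ k, homogeneousComponent k x ∈ L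

/-- The Hilbert series of a subspace of a polynomial ring. -/
noncomputable def hilbertSeries (L : Submodule K (MvPolynomial σ K)) : PowerSeries ℤ :=
  PowerSeries.mk fun k =>
    (Module.finrank K (L ⊓ homogeneousSubmodule σ K k : Submodule K (MvPolynomial σ K)) : ℤ)

theorem IsGraded.sup {L N : Submodule K (MvPolynomial σ K)} (hL : IsGraded L) (hN : IsGraded N) :
    IsGraded (L ⊔ N) := by
  intro x hx k
  obtain ⟨y, hy, z, hz, rfl⟩ := Submodule.mem_sup.1 hx
  rw [map_add]
  exact Submodule.add_mem_sup (hL y hy k) (hN z hz k)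

theorem IsGraded.map_mulLeft {L : Submodule K (MvPolynomial σ K)} (hL : IsGraded L)
    {f : MvPolynomial σ K} {d : ℕ} (hf : f.IsHomogeneous d) :
    IsGraded (L.map (LinearMap.mulLeft K f)) := by
  rintro _ ⟨x, hx, rfl⟩ k
  rw [LinearMap.mulLeft_apply, hf.homogeneousComponent_mul]
  split_ifs
  · exact Submodule.mem_map_of_mem (hL x hx _)
  · exact zero_mem _

theorem IsGraded.inf_comap_mulLeft {L N : Submodule K (MvPolynomial σ K)} (hL : IsGraded L)
    (hN : IsGraded N) {f : MvPolynomial σ K} {d : ℕ} (hf : f.IsHomogeneous d) :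
    IsGraded (L ⊓ N.comap (LinearMap.mulLeft K f)) := by
  rintro x ⟨hx, hx'⟩ k
  refine ⟨hL x hx k, ?_⟩
  have := hN _ hx' (k + d)
  rwa [LinearMap.mulLeft_apply, hf.homogeneousComponent_mul, if_pos (by omega),
    Nat.add_sub_cancel] at this

theorem finiteDimensional_inf_homogeneousSubmodule [Finite σ]
    (L : Submodule K (MvPolynomial σ K)) (k : ℕ) :
    FiniteDimensional K (L ⊓ homogeneousSubmodule σ K k : Submodule K (MvPolynomial σ K)) := by
  have : FiniteDimensional K (homogeneousSubmodule σ K k) :=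
    Module.Finite.iff_fg.2 (homogeneousSubmodule_fg σ K k)
  exact Submodule.finiteDimensional_of_le inf_le_right

theorem hilbertSeries_exact [Finite σ] {L N : Submodule K (MvPolynomial σ K)} (hL : IsGraded L)
    (hN : IsGraded N) {f : MvPolynomial σ K} {d : ℕ} (hf : f.IsHomogeneous d) :
    PowerSeries.X ^ d *
        (hilbertSeries L - hilbertSeries (L ⊓ N.comap (LinearMap.mulLeft K f))) =
      hilbertSeries (N ⊔ L.map (LinearMap.mulLeft K f)) - hilbertSeries N := by
  have fd := finiteDimensional_inf_homogeneousSubmodule (σ := σ) (K := K)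
  ext k
  rw [PowerSeries.coeff_X_pow_mul']
  simp only [map_sub, hilbertSeries, PowerSeries.coeff_mk]
  have hker : (N ⊔ L.map (LinearMap.mulLeft K f)) ⊓ homogeneousSubmodule σ K k ⊓
      LinearMap.ker N.mkQ = N ⊓ homogeneousSubmodule σ K k := by
    rw [Submodule.ker_mkQ]
    apply le_antisymm
    · exact fun x hx => ⟨hx.2, hx.1.2⟩
    · exact fun x hx => ⟨⟨Submodule.mem_sup_left hx.1, hx.2⟩, hx.1⟩
  have h₁ := Submodule.finrank_map_add_finrank_inf_ker N.mkQ
    ((N ⊔ L.map (LinearMap.mulLeft K f)) ⊓ homogeneousSubmodule σ K k)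
  rw [hker] at h₁
  split_ifs with hk
  · have h₂ := Submodule.finrank_map_add_finrank_inf_ker (N.mkQ ∘ₗ LinearMap.mulLeft K f)
      (L ⊓ homogeneousSubmodule σ K (k - d))
    rw [LinearMap.ker_comp, Submodule.ker_mkQ, inf_right_comm] at h₂
    have himage : (L ⊓ homogeneousSubmodule σ K (k - d)).map (N.mkQ ∘ₗ LinearMap.mulLeft K f) =
        ((N ⊔ L.map (LinearMap.mulLeft K f)) ⊓ homogeneousSubmodule σ K k).map N.mkQ := by
      apply le_antisymm
      · rintro _ ⟨x, ⟨hx, hx'⟩, rfl⟩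
        refine ⟨f * x, ⟨Submodule.mem_sup_right ⟨x, hx, rfl⟩, ?_⟩, rfl⟩
        have := hf.mul ((mem_homogeneousSubmodule _ _).1 hx')
        rwa [Nat.add_sub_cancel' hk] at this
      · rintro _ ⟨x, ⟨hx, hx'⟩, rfl⟩
        obtain ⟨y, hy, _, ⟨z, hz, rfl⟩, rfl⟩ := Submodule.mem_sup.1 hx
        refine ⟨homogeneousComponent (k - d) z,
          ⟨hL z hz _, homogeneousComponent_isHomogeneous _ _⟩, ?_⟩
        rw [← homogeneousComponent_eq_self hx', map_add, LinearMap.mulLeft_apply,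
          hf.homogeneousComponent_mul, if_pos hk, map_add,
          (Submodule.Quotient.mk_eq_zero N (x := homogeneousComponent k y)).2 (hN y hy k) |>
            (Submodule.mkQ_apply N _).trans, zero_add]
        rfl
    rw [himage] at h₂
    omega
  · have : (N ⊔ L.map (LinearMap.mulLeft K f)) ⊓ homogeneousSubmodule σ K k =
        N ⊓ homogeneousSubmodule σ K k := by
      refine le_antisymm (fun x ⟨hx, hx'⟩ => ⟨?_, hx'⟩) (inf_le_inf_right _ le_sup_left)
      obtain ⟨y, hy, _, ⟨z, hz, rfl⟩, rfl⟩ := Submodule.mem_sup.1 hx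
      rw [← homogeneousComponent_eq_self hx', map_add, LinearMap.mulLeft_apply,
        hf.homogeneousComponent_mul, if_neg hk, add_zero]
      exact hN y hy k
    rw [this, sub_self]

theorem exists_polynomial_hilbertSeries_sub [Finite σ] {L N : Submodule K (MvPolynomial σ K)}
    (hNL : N ≤ L) {D : ℕ} (hD : ∀ x ∈ L, ∀ k, D < k → homogeneousComponent k x ∈ N) :
    ∃ P : Polynomial ℤ, hilbertSeries L - hilbertSeries N = P := by
  refine ⟨PowerSeries.trunc (D + 1) (hilbertSeries L - hilbertSeries N), ?_⟩
  ext k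
  rw [Polynomial.coeff_coe, PowerSeries.coeff_trunc]
  split_ifs with hk
  · rfl
  · have : L ⊓ homogeneousSubmodule σ K k = N ⊓ homogeneousSubmodule σ K k := by
      refine le_antisymm (fun x ⟨hx, hx'⟩ => ⟨?_, hx'⟩) (inf_le_inf_right _ hNL)
      rw [← homogeneousComponent_eq_self hx']
      exact hD x hx k (by omega)
    simp only [map_sub, hilbertSeries, PowerSeries.coeff_mk]
    rw [this, sub_self]

theorem exists_bound_homogeneousComponent_mem {ι : Type*} {f : ι → MvPolynomial σ K}
    [IsNoetherian (Algebra.adjoin K (Set.range f)) (MvPolynomial σ K)]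
    {L N : Submodule (Algebra.adjoin K (Set.range f)) (MvPolynomial σ K)}
    (hN : IsGraded (N.restrictScalars K)) (hNL : N ≤ L) (hkill : ∀ i, ∀ x ∈ L, f i * x ∈ N) :
    ∃ D, ∀ x ∈ L, ∀ k, D < k → homogeneousComponent k x ∈ N := by
  obtain ⟨s, rfl⟩ := IsNoetherian.noetherian L
  set L := Submodule.span (Algebra.adjoin K (Set.range f)) (s : Set (MvPolynomial σ K))
  refine ⟨s.sup totalDegree, fun x hx => ?_⟩
  suffices x ∈ L ∧ ∀ k, s.sup totalDegree < k → homogeneousComponent k x ∈ N from this.2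
  induction hx using Submodule.span_induction with
  | mem x hx =>
    refine ⟨Submodule.subset_span hx, fun k hk => ?_⟩
    rw [homogeneousComponent_eq_zero _ _ ((Finset.le_sup hx).trans_lt hk)]
    exact zero_mem _
  | zero => exact ⟨zero_mem _, fun k _ => by rw [map_zero]; exact zero_mem _⟩
  | add x y _ _ hx hy =>
    exact ⟨add_mem hx.1 hy.1, fun k hk => by
      rw [map_add]; exact add_mem (hx.2 k hk) (hy.2 k hk)⟩
  | smul a x _ hx =>
    obtain ⟨a, ha⟩ := a
    refine ⟨L.smul_mem _ hx.1, ?_⟩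
    change ∀ k, _ → homogeneousComponent k (a * x) ∈ N
    induction ha using Algebra.adjoin_induction generalizing x with
    | mem a ha =>
      obtain ⟨i, rfl⟩ := ha
      exact fun k _ => hN _ (hkill i x hx.1) k
    | algebraMap r =>
      intro k hk
      rw [← Algebra.smul_def, map_smul]
      exact (N.restrictScalars K).smul_mem r (hx.2 k hk)
    | add a b _ _ iha ihb =>
      intro k hk
      rw [add_mul, map_add]
      exact add_mem (iha x ‹_› hx k hk) (ihb x ‹_› hx k hk)
    | mul a b ha hb iha ihb =>
      rw [mul_assoc]
      exact iha (b * x) (L.smul_mem ⟨b, hb⟩ hx.1) ⟨L.smul_mem ⟨b, hb⟩ hx.1, ihb x ‹_› hx⟩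

theorem exists_polynomial_hilbertSeries_sub_mul_prod [Finite σ] {ι : Type*}
    {f : ι → MvPolynomial σ K} {d : ι → ℕ} (hf : ∀ i, (f i).IsHomogeneous (d i))
    [IsNoetherian (Algebra.adjoin K (Set.range f)) (MvPolynomial σ K)] (s : Finset ι)
    (L N : Submodule (Algebra.adjoin K (Set.range f)) (MvPolynomial σ K))
    (hL : IsGraded (L.restrictScalars K)) (hN : IsGraded (N.restrictScalars K)) (hNL : N ≤ L)
    (hkill : ∀ i ∉ s, ∀ x ∈ L, f i * x ∈ N) :
    ∃ P : Polynomial ℤ,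
      (hilbertSeries (L.restrictScalars K) - hilbertSeries (N.restrictScalars K)) *
        ∏ i ∈ s, (1 - PowerSeries.X ^ d i) = P := by
  classical
  induction s using Finset.induction_on generalizing L N with
  | empty =>
    obtain ⟨D, hD⟩ := exists_bound_homogeneousComponent_mem hN hNL fun i => hkill i (by simp)
    obtain ⟨P, hP⟩ := exists_polynomial_hilbertSeries_sub (L := L.restrictScalars K)
      (N := N.restrictScalars K) hNL hD
    exact ⟨P, by simpa using hP⟩
  | insert j s hj ih =>
    have hmul (M : Submodule (Algebra.adjoin K (Set.range f)) (MvPolynomial σ K)) (x) (hx : x ∈ M) :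
        f j * x ∈ M :=
      M.smul_mem ⟨f j, Algebra.subset_adjoin ⟨j, rfl⟩⟩ hx
    let m := LinearMap.mulLeft (Algebra.adjoin K (Set.range f)) (f j)
    have hsup : (N ⊔ L.map m).restrictScalars K =
        N.restrictScalars K ⊔ (L.restrictScalars K).map (LinearMap.mulLeft K (f j)) := by
      ext x
      simp only [Submodule.restrictScalars_mem, Submodule.mem_sup]
      rfl
    have hinf : (L ⊓ N.comap m).restrictScalars K =
        L.restrictScalars K ⊓ (N.restrictScalars K).comap (LinearMap.mulLeft K (f j)) := rfl
    have hsplit (i : ι) (hi : i ∉ s) : i = j ∨ i ∉ insert j s := by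
      by_cases h : i = j <;> simp [h, hi]
    obtain ⟨P, hP⟩ := ih L (N ⊔ L.map m) hL
      (by rw [hsup]; exact hN.sup (hL.map_mulLeft (hf j)))
      (sup_le hNL (by rintro _ ⟨x, hx, rfl⟩; exact hmul L x hx))
      (by
        intro i hi x hx
        obtain rfl | hi' := hsplit i hi
        · exact Submodule.mem_sup_right ⟨x, hx, rfl⟩
        · exact Submodule.mem_sup_left (hkill i hi' x hx))
    obtain ⟨Q, hQ⟩ := ih (L ⊓ N.comap m) N
      (by rw [hinf]; exact hL.inf_comap_mulLeft hN (hf j)) hN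
      (le_inf hNL fun x hx => hmul N x hx)
      (by
        intro i hi x hx
        obtain rfl | hi' := hsplit i hi
        · exact hx.2
        · exact hkill i hi' x hx.1)
    have key := hilbertSeries_exact hL hN (hf j)
    rw [← hsup, ← hinf] at key
    refine ⟨P - Polynomial.X ^ d j * Q, ?_⟩
    rw [Finset.prod_insert hj]
    push_cast
    rw [← hP, ← hQ]
    linear_combination (-∏ i ∈ s, (1 - PowerSeries.X ^ d i)) * key

theorem finite_adjoin_of_forall_eval_eq_zero [Finite σ] [IsAlgClosed K] {ι : Type*} [Finite ι]
    {f : ι → MvPolynomial σ K} {d : ι → ℕ} (hf : ∀ i, (f i).IsHomogeneous (d i))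
    (hd : ∀ i, 0 < d i) (hzero : ∀ z : σ → K, (∀ i, eval z (f i) = 0) → z = 0) :
    Module.Finite (Algebra.adjoin K (Set.range f)) (MvPolynomial σ K) := by
  have := Fintype.ofFinite ι
  set J := Ideal.span (Set.range f)
  have hrad : idealOfVars σ K ≤ J.radical := by
    rw [← vanishingIdeal_zeroLocus_eq_radical (K := K), idealOfVars, Ideal.span_le]
    rintro _ ⟨i, rfl⟩
    rw [SetLike.mem_coe, mem_vanishingIdeal_iff]
    intro z hz
    have : z = 0 := hzero z fun j => by
      simpa using hz (f j) (Ideal.subset_span ⟨j, rfl⟩)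
    simp [this]
  obtain ⟨M, hM⟩ := Ideal.exists_radical_pow_le_of_fg J (IsNoetherian.noetherian _)
  have hpow : idealOfVars σ K ^ M ≤ J := (Ideal.pow_right_mono hrad M).trans hM
  let W := Submodule.span (Algebra.adjoin K (Set.range f))
    ((fun m : σ →₀ ℕ => monomial m (1 : K)) '' {m | m.degree < M})
  have hW (k : ℕ) (p : MvPolynomial σ K) (hp : p.IsHomogeneous k) : p ∈ W := by
    induction k using Nat.strong_induction_on generalizing p with
    | _ k ih =>
    rcases lt_or_ge k M with hk | hk
    · rw [p.as_sum]
      refine sum_mem fun m hm => ?_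
      have : monomial m (coeff m p) = coeff m p • monomial m (1 : K) := by
        rw [smul_monomial, smul_eq_mul, mul_one]
      rw [this]
      refine (W.restrictScalars K).smul_mem _ (Submodule.subset_span ⟨m, ?_, rfl⟩)
      exact (hp.degree_eq_sum_deg_support hm).symm.trans_lt hk
    · have hpJ : p ∈ J := hpow <| (mem_pow_idealOfVars_iff M p).2 fun m hm =>
        hk.trans (hp.degree_eq_sum_deg_support hm).le
      obtain ⟨c, hc⟩ := Ideal.mem_span_range_iff_exists_fun.1 hpJ
      rw [← homogeneousComponent_eq_self hp, ← hc, map_sum]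
      refine sum_mem fun i _ => ?_
      rw [mul_comm, (hf i).homogeneousComponent_mul]
      split_ifs with hi
      · exact W.smul_mem ⟨f i, Algebra.subset_adjoin ⟨i, rfl⟩⟩
          (ih (k - d i) (by have := hd i; omega) _ (homogeneousComponent_isHomogeneous _ _))
      · exact zero_mem _
  refine Module.Finite.of_fg_top ?_
  have htop : W = ⊤ := by
    refine eq_top_iff.2 fun p _ => ?_
    rw [← sum_homogeneousComponent p]
    exact sum_mem fun k _ => hW k _ (homogeneousComponent_isHomogeneous _ _)
  rw [← htop]
  exact Submodule.fg_span ((Finsupp.finite_of_degree_lt M).image _)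

theorem isNoetherian_adjoin_of_forall_eval_eq_zero [Finite σ] [IsAlgClosed K] {ι : Type*}
    [Finite ι] {f : ι → MvPolynomial σ K} {d : ι → ℕ} (hf : ∀ i, (f i).IsHomogeneous (d i))
    (hd : ∀ i, 0 < d i) (hzero : ∀ z : σ → K, (∀ i, eval z (f i) = 0) → z = 0) :
    IsNoetherian (Algebra.adjoin K (Set.range f)) (MvPolynomial σ K) := by
  have := finite_adjoin_of_forall_eval_eq_zero hf hd hzero
  have : IsNoetherianRing (Algebra.adjoin K (Set.range f)) := by
    have : Algebra.FiniteType K (Algebra.adjoin K (Set.range f)) :=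
      Subalgebra.fg_iff_finiteType _ |>.1 ⟨(Set.finite_range f).toFinset, by simp⟩
    exact Algebra.FiniteType.isNoetherianRing K _
  exact isNoetherian_of_isNoetherianRing_of_finite _ _

theorem hilbertSeries_bot : hilbertSeries (⊥ : Submodule K (MvPolynomial σ K)) = 0 := by
  ext k
  rw [hilbertSeries, PowerSeries.coeff_mk, bot_inf_eq, finrank_bot, Nat.cast_zero, map_zero]

end GradedHilbert

theorem MvPolynomial.IsWeightedHomogeneous.aeval {σ τ R : Type*} [CommSemiring R] {w : σ → ℕ}
    {p : MvPolynomial σ R} {m : ℕ} (hp : p.IsWeightedHomogeneous w m) {g : σ → MvPolynomial τ R}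
    (hg : ∀ i, (g i).IsHomogeneous (w i)) : (MvPolynomial.aeval g p).IsHomogeneous m := by
  rw [p.as_sum, map_sum]
  refine IsHomogeneous.sum _ _ _ fun a ha => ?_
  rw [aeval_monomial, algebraMap_eq]
  refine IsHomogeneous.C_mul ?_ _
  rw [← hp (mem_support_iff.1 ha), Finsupp.weight_apply]
  refine IsHomogeneous.prod _ _ _ fun i _ => ?_
  simpa only [smul_eq_mul, mul_comm] using (hg i).pow (a i)

theorem MvPolynomial.homogeneousComponent_aeval {σ τ R : Type*} [CommSemiring R] {w : σ → ℕ}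
    {g : σ → MvPolynomial τ R} (hg : ∀ i, (g i).IsHomogeneous (w i)) (k : ℕ)
    (p : MvPolynomial σ R) :
    homogeneousComponent k (aeval g p) = aeval g (weightedHomogeneousComponent w k p) := by
  classical
  induction p using MvPolynomial.induction_on' with
  | monomial m c =>
    have h := isWeightedHomogeneous_monomial (R := R) w m c rfl
    rw [homogeneousComponent_of_mem (h.aeval hg), weightedHomogeneousComponent_of_mem h]
    split_ifs <;> simp
  | add p q hp hq => simp only [map_add, hp, hq]

theorem MvPolynomial.isHomogeneous_esymm (σ R : Type*) [Fintype σ] [CommSemiring R] (k : ℕ) :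
    (esymm σ R k).IsHomogeneous k := by
  refine IsHomogeneous.sum _ _ _ fun s hs => ?_
  have := IsHomogeneous.prod s (fun i => (X i : MvPolynomial σ R)) (fun _ => 1)
    fun i _ => isHomogeneous_X R i
  simpa [(Finset.mem_powersetCard.1 hs).2] using this

theorem PowerSeries.mk_dvd_mul_one_sub_X_pow {R : Type*} [CommRing R] {w : ℕ} (hw : 0 < w) :
    (PowerSeries.mk fun k => if w ∣ k then (1 : R) else 0) * (1 - PowerSeries.X ^ w) = 1 := by
  ext k
  rw [mul_sub, mul_one, map_sub, PowerSeries.coeff_mul_X_pow', PowerSeries.coeff_mk,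
    PowerSeries.coeff_one]
  rcases le_or_gt w k with h | h
  · obtain ⟨j, rfl⟩ := Nat.exists_eq_add_of_le h
    rw [if_pos h, PowerSeries.coeff_mk, if_neg (by omega : w + j ≠ 0), Nat.add_sub_cancel_left]
    simp
  · rw [if_neg (by omega : ¬w ≤ k), sub_zero]
    refine if_congr ⟨fun hk => Nat.eq_zero_of_dvd_of_lt hk h, ?_⟩ rfl rfl
    rintro rfl
    exact dvd_zero w

theorem PowerSeries.mk_card_weight_mul_prod {ι R : Type*} [Fintype ι] [CommRing R] {w : ι → ℕ}
    (hw : ∀ i, 0 < w i) :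
    (PowerSeries.mk fun k => (Nat.card {m : ι →₀ ℕ | Finsupp.weight w m = k} : R)) *
      ∏ i, (1 - PowerSeries.X ^ w i) = 1 := by
  classical
  have : (PowerSeries.mk fun k => (Nat.card {m : ι →₀ ℕ | Finsupp.weight w m = k} : R)) =
      ∏ i, PowerSeries.mk fun k => if w i ∣ k then (1 : R) else 0 := by
    ext k
    rw [PowerSeries.coeff_prod, PowerSeries.coeff_mk]
    simp only [PowerSeries.coeff_mk, Finset.prod_ite_zero, Finset.prod_const_one]
    rw [Finset.sum_boole, Nat.card_coe_set_eq, Set.ncard_eq_toFinset_card _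
      (Finsupp.finite_of_nat_weight_eq w (fun i => (hw i).ne') k)]
    congr 1
    refine Finset.card_bij (fun m _ => Finsupp.equivFunOnFinite.symm fun i => w i * m i) ?_ ?_ ?_
    · intro m hm
      have hm : Finsupp.weight w m = k := by simpa using hm
      rw [Finsupp.weight_apply, Finsupp.sum_fintype _ _ (by simp)] at hm
      simpa [mul_comm] using hm
    · intro m _ m' _ h
      ext i
      exact Nat.eq_of_mul_eq_mul_left (hw i) (DFunLike.congr_fun h i)
    · intro l hl
      simp only [Finset.mem_filter, Finset.mem_finsuppAntidiag, Finset.mem_univ, true_imp_iff,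
        Finset.subset_univ, and_true] at hl
      refine ⟨Finsupp.equivFunOnFinite.symm fun i => l i / w i, ?_, ?_⟩
      · simp only [Set.Finite.mem_toFinset]
        change Finsupp.weight w _ = k
        rw [Finsupp.weight_apply, Finsupp.sum_fintype _ _ (by simp), ← hl.1]
        exact Finset.sum_congr rfl fun i _ => Nat.div_mul_cancel (hl.2 i)
      · ext i
        exact Nat.mul_div_cancel' (hl.2 i)
  rw [this, ← Finset.prod_mul_distrib]
  exact Finset.prod_eq_one fun i _ => mk_dvd_mul_one_sub_X_pow (hw i)

namespace GradedHilbert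

theorem hilbertSeries_symmetricSubalgebra_mul_prod (K : Type*) [Field K] (n : ℕ) :
    hilbertSeries (Subalgebra.toSubmodule (symmetricSubalgebra (Fin n) K)) *
      ∏ i : Fin n, (1 - PowerSeries.X ^ (i + 1 : ℕ)) = 1 := by
  let w : Fin n → ℕ := fun i => i + 1
  have hw (i : Fin n) : (esymm (Fin n) K (i + 1)).IsHomogeneous (w i) := isHomogeneous_esymm _ _ _
  let φ : MvPolynomial (Fin n) K →ₐ[K] MvPolynomial (Fin n) K :=
    aeval fun i : Fin n => esymm (Fin n) K (i + 1)
  have hφ (q) : φ q = (esymmAlgHom (Fin n) K n q).val := (esymmAlgHom_apply q).symm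
  have hinj : Function.Injective φ := fun p q h =>
    (esymmAlgHom_fin_bijective K n).1 (Subtype.ext (by rw [← hφ, ← hφ, h]))
  have hmap (k : ℕ) : Subalgebra.toSubmodule (symmetricSubalgebra (Fin n) K) ⊓
      homogeneousSubmodule (Fin n) K k =
        (weightedHomogeneousSubmodule K w k).map φ.toLinearMap := by
    apply le_antisymm
    · rintro p ⟨hp, hp'⟩
      obtain ⟨q, hq⟩ := (esymmAlgHom_fin_bijective K n).2 ⟨p, hp⟩
      refine ⟨weightedHomogeneousComponent w k q,
        weightedHomogeneousComponent_isWeightedHomogeneous k q, ?_⟩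
      have hqp : φ q = p := by rw [hφ, hq]
      rw [← homogeneousComponent_eq_self hp', ← hqp]
      exact (homogeneousComponent_aeval hw k q).symm
    · rintro _ ⟨q, hq, rfl⟩
      refine ⟨?_, IsWeightedHomogeneous.aeval hq hw⟩
      change φ q ∈ symmetricSubalgebra (Fin n) K
      rw [hφ]
      exact Subtype.prop _
  have hcard (k : ℕ) : Module.finrank K (Subalgebra.toSubmodule (symmetricSubalgebra (Fin n) K) ⊓
      homogeneousSubmodule (Fin n) K k : Submodule K _) =
        Nat.card {m : Fin n →₀ ℕ | Finsupp.weight w m = k} := by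
    rw [hmap, ← (Submodule.equivMapOfInjective φ.toLinearMap hinj _).finrank_eq,
      weightedHomogeneousSubmodule_eq_finsupp_supported]
    have := (Finsupp.finite_of_nat_weight_eq w (fun i => i.1.succ_ne_zero) k).fintype
    rw [(AddMonoidAlgebra.supportedEquivFinsupp _).finrank_eq, Module.finrank_finsupp_self,
      Nat.card_eq_fintype_card]
  simp only [hilbertSeries, hcard]
  exact PowerSeries.mk_card_weight_mul_prod (w := w) fun i => i.1.succ_pos

theorem isGraded_symmetricSubalgebra (σ K : Type*) [Field K] :
    IsGraded (Subalgebra.toSubmodule (symmetricSubalgebra σ K)) := by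
  intro p hp k e
  rw [rename_homogeneousComponent, (show p.IsSymmetric from hp) e]

end GradedHilbert

theorem Polynomial.prod_dvd_prod_of_prod_one_sub_X_pow_dvd {ι : Type*} [Fintype ι] {a b : ι → ℕ}
    (h : (∏ i, (1 - X ^ a i) : Polynomial ℤ) ∣ ∏ i, (1 - X ^ b i)) : ∏ i, a i ∣ ∏ i, b i := by
  have hfac (c : ι → ℕ) : (∏ i, (1 - X ^ c i) : Polynomial ℤ) =
      (1 - X) ^ Fintype.card ι * ∏ i, ∑ j ∈ Finset.range (c i), X ^ j := by
    rw [← Finset.card_univ, ← Finset.prod_const, ← Finset.prod_mul_distrib]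
    exact Finset.prod_congr rfl fun i _ => (mul_neg_geom_sum X (c i)).symm
  have hne : (1 - X : Polynomial ℤ) ≠ 0 := fun h => by simpa using congrArg (eval 0) h
  rw [hfac, hfac, mul_dvd_mul_iff_left (pow_ne_zero _ hne)] at h
  have := eval_dvd (x := 1) h
  simp only [eval_prod, eval_geom_sum, one_pow, Finset.sum_const, Finset.card_range] at this
  exact_mod_cast (by simpa using this : (∏ i, (a i : ℤ)) ∣ ∏ i, (b i : ℤ))

/-- Let `f₁, …, f_n` be homogeneous symmetric polynomials in `ℂ[x₁,…,x_n]`,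
each of positive degree, whose only common zero in `ℂ^n` is the origin. Then `n!` divides
the product of their degrees. -/
theorem stmt9 (n : ℕ) (f : Fin n → MvPolynomial (Fin n) ℂ) (d : Fin n → ℕ)
    (hdeg : ∀ i, (f i).IsHomogeneous (d i)) (hpos : ∀ i, 0 < d i)
    (hsym : ∀ i, (f i).IsSymmetric)
    (hreg : ∀ z : Fin n → ℂ, (∀ i, eval z (f i) = 0) → z = 0) :
    n.factorial ∣ ∏ i, d i := by
  have := GradedHilbert.isNoetherian_adjoin_of_forall_eval_eq_zero hdeg hpos hreg
  have hle : Algebra.adjoin ℂ (Set.range f) ≤ symmetricSubalgebra (Fin n) ℂ :=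
    Algebra.adjoin_le (Set.range_subset_iff.2 hsym)
  let L : Submodule (Algebra.adjoin ℂ (Set.range f)) (MvPolynomial (Fin n) ℂ) :=
    { Subalgebra.toSubmodule (symmetricSubalgebra (Fin n) ℂ) with
      smul_mem' := fun a _ hx => mul_mem (hle a.2) hx }
  have hL : L.restrictScalars ℂ = Subalgebra.toSubmodule (symmetricSubalgebra (Fin n) ℂ) := rfl
  obtain ⟨P, hP⟩ := GradedHilbert.exists_polynomial_hilbertSeries_sub_mul_prod hdeg Finset.univ L ⊥
    (GradedHilbert.isGraded_symmetricSubalgebra (Fin n) ℂ)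
    (fun x hx k => by
      rw [Submodule.restrictScalars_mem, Submodule.mem_bot] at hx
      rw [hx, map_zero]
      exact zero_mem _) bot_le (by simp)
  rw [Submodule.restrictScalars_bot, GradedHilbert.hilbertSeries_bot, sub_zero, hL] at hP
  rw [← Finset.prod_range_add_one_eq_factorial, ← Fin.prod_univ_eq_prod_range]
  refine Polynomial.prod_dvd_prod_of_prod_one_sub_X_pow_dvd ⟨P, ?_⟩
  have := GradedHilbert.hilbertSeries_symmetricSubalgebra_mul_prod ℂ n
  apply Polynomial.coe_injective
  simp only [← Polynomial.coeToPowerSeries.ringHom_apply, map_mul, map_prod, map_sub, map_one,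
    map_pow]
  simp only [Polynomial.coeToPowerSeries.ringHom_apply, Polynomial.coe_X]
  rw [← hP, mul_left_comm, ← mul_assoc, this, one_mul]
end

section
/- Let a and n be positive integers. Then the n consecutive power sums p_a(n), p_{a+1}(n), …, p_{a+n−1}(n) have no common zero in ℂ^n other than the origin; that is, they form a regular sequence in ℂ[x_1,…,x_n]. -/
open Polynomial in
/-- If the weighted moments `∑ i, w i * z i ^ j` vanish for all `j < n`, then
`∑ i, w i * q (z i)` vanishes for every polynomial `q` of degree less than `n`. -/
theorem sum_mul_eval_eq_zero_of_moments {R ι : Type*} [CommSemiring R] [Fintype ι] {n : ℕ}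
    {w z : ι → R} (h : ∀ j ∈ Finset.range n, ∑ i, w i * z i ^ j = 0)
    {q : R[X]} (hq : q.natDegree < n) : ∑ i, w i * q.eval (z i) = 0 := by
  simp_rw [eval_eq_sum_range' hq, Finset.mul_sum]
  rw [Finset.sum_comm]
  refine Finset.sum_eq_zero fun j hj => ?_
  simp_rw [mul_left_comm (w _)]
  rw [← Finset.mul_sum, h j hj, mul_zero]

/-- Let `a` and `n` be positive integers. Then the `n` consecutive power sums
`p_a(n), p_{a+1}(n), …, p_{a+n−1}(n)` have no common zero in `ℂ^n` other than the origin;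
that is, they form a regular sequence in `ℂ[x₁,…,x_n]`. -/
theorem stmt10 (a n : ℕ) (ha : 0 < a) (hn : 0 < n) :
    ∀ z : Fin n → ℂ, (∀ j ∈ Finset.range n, ∑ i, z i ^ (a + j) = 0) → z = 0 := by
  intro z h
  funext k
  by_contra hk
  let s := (Finset.univ.image z).erase (z k)
  let q : Polynomial ℂ := ∏ v ∈ s, (Polynomial.X - Polynomial.C v)
  have hq : q.natDegree < n := by
    rw [Polynomial.natDegree_finsetProd_X_sub_C_eq_card]
    calc s.card < (Finset.univ.image z).card :=
          Finset.card_erase_lt_of_mem (Finset.mem_image_of_mem z (Finset.mem_univ k))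
      _ ≤ n := by simpa using Finset.card_image_le (s := Finset.univ) (f := z)
  have heval (x : ℂ) : q.eval x = ∏ v ∈ s, (x - v) := by
    simp [q, Polynomial.eval_prod]
  have hqk : q.eval (z k) ≠ 0 := by
    rw [heval]
    exact Finset.prod_ne_zero_iff.mpr fun v hv =>
      sub_ne_zero.mpr (Finset.ne_of_mem_erase hv).symm
  have hsum : ∑ i, z i ^ a * q.eval (z i) = 0 :=
    sum_mul_eval_eq_zero_of_moments (by simpa only [pow_add] using h) hq
  have hterm (i : Fin n) : z i ^ a * q.eval (z i) =
      if z i = z k then z k ^ a * q.eval (z k) else 0 := by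
    split_ifs with hi
    · rw [hi]
    · rw [heval, Finset.prod_eq_zero (i := z i) (by simp [s, hi]) (sub_self _), mul_zero]
  rw [Finset.sum_congr rfl fun i _ => hterm i] at hsum
  rw [← Finset.sum_filter, Finset.sum_const, nsmul_eq_mul] at hsum
  refine mul_ne_zero ?_ (mul_ne_zero (pow_ne_zero a hk) hqk) hsum
  exact Nat.cast_ne_zero.mpr (Finset.card_ne_zero_of_mem (a := k) (by simp))
end

section
/- Let a and n be positive integers. Then the n consecutive complete homogeneous symmetric polynomials h_a(n), h_{a+1}(n), …, h_{a+n−1}(n) have no common zero in ℂ^n other than the origin; that is, they form a regular sequence in ℂ[x_1,…,x_n]. -/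
open Finset PowerSeries in
/-- The geometric series `∑ c ^ k X ^ k` is inverse to `1 - c X`. -/
theorem one_sub_C_mul_X_mul_mk_pow {R : Type*} [CommRing R] (c : R) :
    (1 - C c * X) * PowerSeries.mk (fun k => c ^ k) = 1 := by
  ext k
  cases k with
  | zero => simp [sub_mul, mul_assoc]
  | succ k => simp [sub_mul, mul_assoc, coeff_succ_X_mul, pow_succ', coeff_one]

open Finset PowerSeries in
/-- The generating function of the complete homogeneous symmetric polynomials is inverse to
`∏ (1 - z i X)`. -/
theorem prod_one_sub_mul_mk_sum_antidiagonalTuple {R : Type*} [CommRing R] :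
    ∀ (n : ℕ) (z : Fin n → R),
      (∏ i, (1 - C (z i) * X)) *
        PowerSeries.mk (fun k => ∑ d ∈ Finset.Nat.antidiagonalTuple n k, ∏ i, z i ^ d i) = 1
  | 0, z => by
    ext k
    cases k <;> simp [coeff_one]
  | n + 1, z => by
    have hsplit :
        PowerSeries.mk (fun k => ∑ d ∈ Finset.Nat.antidiagonalTuple (n + 1) k, ∏ i, z i ^ d i) =
          PowerSeries.mk (fun k => z 0 ^ k) * PowerSeries.mk (fun k =>
            ∑ d ∈ Finset.Nat.antidiagonalTuple n k, ∏ i, z (Fin.succ i) ^ d i) := by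
      ext k
      simp only [coeff_mk, coeff_mul, mul_sum]
      rw [sum_sigma']
      symm
      refine sum_bij' (fun x _ => Fin.cons x.1.1 x.2)
        (fun d _ => ⟨(d 0, ∑ i, Fin.tail d i), Fin.tail d⟩) ?_ ?_ ?_ ?_ ?_
      · rintro ⟨⟨p, q⟩, d⟩ h
        simp_all [Finset.Nat.mem_antidiagonalTuple, Fin.sum_univ_succ]
      · intro d h
        simp_all [Finset.Nat.mem_antidiagonalTuple, Fin.sum_univ_succ, Fin.tail]
      · rintro ⟨⟨p, q⟩, d⟩ h
        simp only [mem_sigma, Finset.HasAntidiagonal.mem_antidiagonal, Finset.Nat.mem_antidiagonalTuple] at h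
        simp [h.2]
      · intro d h
        simp
      · rintro ⟨⟨p, q⟩, d⟩ h
        simp [Fin.prod_univ_succ]
    rw [hsplit, Fin.prod_univ_succ, mul_mul_mul_comm, one_sub_C_mul_X_mul_mk_pow, one_mul,
      prod_one_sub_mul_mk_sum_antidiagonalTuple]

open Finset in
/-- If `n` consecutive coefficients of `H`, from index `a` on, vanish, where `E * H = 1` for a
polynomial `E` of degree at most `n` with constant term `1`, then all later ones vanish too. -/
theorem coeff_eq_zero_of_consecutive_eq_zero {R : Type*} [CommRing R] {a n : ℕ} (ha : 0 < a)
    {E : Polynomial R} (hdeg : E.natDegree ≤ n) (hE : E.coeff 0 = 1) {H : PowerSeries R}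
    (hEH : (E : PowerSeries R) * H = 1)
    (h : ∀ j < n, PowerSeries.coeff (a + j) H = 0) (m : ℕ) (hm : a ≤ m) :
    PowerSeries.coeff m H = 0 := by
  induction m using Nat.strong_induction_on with
  | _ m ih =>
    by_cases hmn : m < a + n
    · obtain ⟨j, rfl⟩ := Nat.exists_eq_add_of_le hm
      exact h j (by omega)
    · have hcoeff := congrArg (PowerSeries.coeff m) hEH
      rw [PowerSeries.coeff_mul, PowerSeries.coeff_one, if_neg (by omega),
        sum_eq_single (0, m)] at hcoeff
      · simpa [hE] using hcoeff
      · rintro ⟨p, q⟩ hpq hne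
        rw [Finset.HasAntidiagonal.mem_antidiagonal] at hpq
        have hp : p ≠ 0 := by
          rintro rfl
          exact hne (by simpa using hpq)
        dsimp only at hpq ⊢
        by_cases hpn : p ≤ n
        · rw [ih q (by omega) (by omega), mul_zero]
        · rw [Polynomial.coeff_coe, Polynomial.coeff_eq_zero_of_natDegree_lt (by omega), zero_mul]
      · simp

/-- Let `a` and `n` be positive integers. Then the `n` consecutive complete
homogeneous symmetric polynomials `h_a(n), h_{a+1}(n), …, h_{a+n−1}(n)` have no common zero
in `ℂ^n` other than the origin; that is, they form a regular sequence in `ℂ[x₁,…,x_n]`.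
The value of `h_k(n)` at `z` is `∑_{d₁+⋯+d_n = k} ∏ z_i^{d_i}`. -/
theorem stmt11 (a n : ℕ) (ha : 0 < a) (hn : 0 < n) :
    ∀ z : Fin n → ℂ,
      (∀ j ∈ Finset.range n,
        ∑ d ∈ Finset.Nat.antidiagonalTuple n (a + j), ∏ i : Fin n, z i ^ d i = 0) →
      z = 0 := by
  intro z hz
  set E : Polynomial ℂ := ∏ i, (1 - Polynomial.C (z i) * Polynomial.X) with hE
  set H : PowerSeries ℂ :=
    PowerSeries.mk (fun k => ∑ d ∈ Finset.Nat.antidiagonalTuple n k, ∏ i, z i ^ d i) with hH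
  have hEH : (E : PowerSeries ℂ) * H = 1 := by
    rw [← prod_one_sub_mul_mk_sum_antidiagonalTuple n z, hE,
      ← Polynomial.coeToPowerSeries.ringHom_apply, map_prod]
    simp [hH]
  have hdeg : E.natDegree ≤ n := by
    refine (Polynomial.natDegree_prod_le _ _).trans ?_
    refine (Finset.sum_le_card_nsmul _ _ 1 fun i _ => ?_).trans (by simp)
    compute_degree
  have hE0 : E.coeff 0 = 1 := by
    simp [hE, Polynomial.coeff_zero_eq_eval_zero, Polynomial.eval_prod]
  have hvanish := coeff_eq_zero_of_consecutive_eq_zero ha hdeg hE0 hEH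
    fun j hj => by simpa [hH] using hz j (Finset.mem_range.mpr hj)
  have htrunc : (PowerSeries.trunc a H : PowerSeries ℂ) = H := by
    ext m
    rw [Polynomial.coeff_coe, PowerSeries.coeff_trunc]
    split_ifs with hm
    · rfl
    · exact (hvanish m (not_lt.mp hm)).symm
  have hpoly : E * PowerSeries.trunc a H = 1 := by
    apply Polynomial.coe_injective ℂ
    rw [Polynomial.coe_mul, htrunc, hEH, Polynomial.coe_one]
  funext i
  by_contra hi
  have hroot : E.eval (z i)⁻¹ = 0 := by
    rw [hE, Polynomial.eval_prod]
    refine Finset.prod_eq_zero (Finset.mem_univ i) ?_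
    simp [mul_inv_cancel₀ hi]
  simpa [hroot] using congrArg (Polynomial.eval (z i)⁻¹) hpoly
end

section
/- Let n and m be positive integers with 2 ≤ n ≤ 7, m ∉ {1, n}, and 6 dividing n·m. Then the power sums p_1(3), p_n(3), p_m(3) have no common zero in ℂ^3 other than the origin; that is, they form a regular sequence in ℂ[x_1,x_2,x_3]. -/
/-- Three complex numbers with vanishing `e₁` and `e₂` and some `p_m = 0`, `3 ∣ m`, all vanish. -/
lemma eq_zero_of_esymm_two_eq_zero {x y z : ℂ} {m : ℕ} (h1 : x + y + z = 0)
    (h2 : x * y + y * z + z * x = 0) (hm : 3 ∣ m) (h : x ^ m + y ^ m + z ^ m = 0) :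
    x = 0 ∧ y = 0 ∧ z = 0 := by
  obtain ⟨j, rfl⟩ := hm
  have hx : x ^ 3 = x * y * z := by linear_combination x ^ 2 * h1 - x * h2
  have hy : y ^ 3 = x * y * z := by linear_combination y ^ 2 * h1 - y * h2
  have hz : z ^ 3 = x * y * z := by linear_combination z ^ 2 * h1 - z * h2
  rw [pow_mul, pow_mul, pow_mul, hx, hy, hz] at h
  have h0 : x * y * z = 0 := by
    refine eq_zero_of_pow_eq_zero (n := j) ?_
    linear_combination h / 3
  rw [h0] at hx hy hz
  exact ⟨eq_zero_of_pow_eq_zero hx, eq_zero_of_pow_eq_zero hy, eq_zero_of_pow_eq_zero hz⟩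

/-- If `y + z = 0` and `y ^ m + z ^ m = 0` with `m` even, then `y = z = 0`. -/
lemma eq_zero_of_add_eq_zero_of_even {y z : ℂ} {m : ℕ} (h1 : y + z = 0) (hm : Even m)
    (h : y ^ m + z ^ m = 0) : y = 0 ∧ z = 0 := by
  obtain rfl : z = -y := by linear_combination h1
  rw [hm.neg_pow] at h
  have hy : y = 0 := eq_zero_of_pow_eq_zero (n := m) (by linear_combination h / 2)
  simp [hy]

/-- Three complex numbers with vanishing `e₁` and `e₃` and some `p_m = 0`, `m > 0` even,
all vanish. -/
lemma eq_zero_of_esymm_three_eq_zero {x y z : ℂ} {m : ℕ} (h1 : x + y + z = 0)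
    (h3 : x * y * z = 0) (hm0 : m ≠ 0) (hm : Even m) (h : x ^ m + y ^ m + z ^ m = 0) :
    x = 0 ∧ y = 0 ∧ z = 0 := by
  rcases mul_eq_zero.1 h3 with h3 | rfl
  · rcases mul_eq_zero.1 h3 with rfl | rfl
    · exact ⟨rfl, eq_zero_of_add_eq_zero_of_even (by simpa using h1) hm (by simpa [hm0] using h)⟩
    · obtain ⟨hx, hz⟩ := eq_zero_of_add_eq_zero_of_even (y := x) (z := z)
        (by simpa using h1) hm (by simpa [hm0] using h)
      exact ⟨hx, rfl, hz⟩
  · obtain ⟨hx, hy⟩ := eq_zero_of_add_eq_zero_of_even (y := x) (z := y)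
      (by simpa using h1) hm (by simpa [hm0] using h)
    exact ⟨hx, hy, rfl⟩

/-- The power sums of the roots of `t³ + 6t + 12`. -/
def cubicPowerSum : ℕ → ℤ
  | 0 => 3
  | 1 => 0
  | 2 => -12
  | k + 3 => -6 * cubicPowerSum (k + 1) - 12 * cubicPowerSum k

lemma cubicPowerSum_add_three (k : ℕ) :
    cubicPowerSum (k + 3) = -6 * cubicPowerSum (k + 1) - 12 * cubicPowerSum k := by
  rw [cubicPowerSum]

/-- The recurrence satisfied along residue classes mod `4`. -/
lemma cubicPowerSum_add_twelve (k : ℕ) :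
    cubicPowerSum (k + 12) = 72 * cubicPowerSum (k + 8) - 4752 * cubicPowerSum (k + 4)
      + 20736 * cubicPowerSum k := by
  simp only [cubicPowerSum_add_three]
  ring

/-- If, among the quotients `cubicPowerSum (k₀ + 4 k) / 4 ^ k`, the first is a multiple of `d` and
the next two are odd multiples of `d`, then so are all later ones; in particular they do not
vanish. -/
lemma cubicPowerSum_ne_zero_of_stride (k₀ : ℕ) (d u v w : ℤ) (hd : d ≠ 0)
    (h0 : cubicPowerSum k₀ = d * u) (h1 : cubicPowerSum (k₀ + 4) = 4 * (d * (2 * v + 1)))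
    (h2 : cubicPowerSum (k₀ + 8) = 16 * (d * (2 * w + 1))) (k : ℕ) :
    cubicPowerSum (k₀ + 4 * k + 4) ≠ 0 := by
  have key : ∃ u v w : ℤ, cubicPowerSum (k₀ + 4 * k) = 4 ^ k * (d * u) ∧
      cubicPowerSum (k₀ + 4 * k + 4) = 4 ^ k * (4 * (d * (2 * v + 1))) ∧
      cubicPowerSum (k₀ + 4 * k + 8) = 4 ^ k * (16 * (d * (2 * w + 1))) := by
    induction k with
    | zero => exact ⟨u, v, w, by simp [h0], by simp [h1], by simp [h2]⟩
    | succ k ih =>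
      obtain ⟨u, v, w, e0, e1, e2⟩ := ih
      refine ⟨2 * v + 1, w, 9 * (2 * w + 1) - 297 * v - 149 + 162 * u, ?_, ?_, ?_⟩
      · rw [show k₀ + 4 * (k + 1) = k₀ + 4 * k + 4 by ring, e1]; ring
      · rw [show k₀ + 4 * (k + 1) + 4 = k₀ + 4 * k + 8 by ring, e2]; ring
      · rw [show k₀ + 4 * (k + 1) + 8 = k₀ + 4 * k + 12 by ring, cubicPowerSum_add_twelve,
          e0, e1, e2]
        ring
  obtain ⟨-, v, -, -, e, -⟩ := key
  rw [e]
  have : 2 * v + 1 ≠ 0 := by omega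
  positivity

lemma cubicPowerSum_ne_zero {m : ℕ} (h1 : m ≠ 1) (h6 : m ≠ 6) : cubicPowerSum m ≠ 0 := by
  by_cases hm : m ≤ 4
  · interval_cases m <;> first | contradiction | norm_num [cubicPowerSum]
  have : m % 4 = 0 ∨ m % 4 = 1 ∨ m % 4 = 2 ∨ m % 4 = 3 := by omega
  rcases this with h | h | h | h
  · obtain ⟨k, rfl⟩ : ∃ k, m = 4 + 4 * k + 4 := ⟨(m - 8) / 4, by omega⟩
    exact cubicPowerSum_ne_zero_of_stride 4 8 9 (-68) (-2309) (by norm_num)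
      (by norm_num [cubicPowerSum]) (by norm_num [cubicPowerSum]) (by norm_num [cubicPowerSum]) k
  · obtain ⟨k, rfl⟩ : ∃ k, m = 1 + 4 * k + 4 := ⟨(m - 5) / 4, by omega⟩
    exact cubicPowerSum_ne_zero_of_stride 1 2 0 22 283 (by norm_num)
      (by norm_num [cubicPowerSum]) (by norm_num [cubicPowerSum]) (by norm_num [cubicPowerSum]) k
  · obtain ⟨k, rfl⟩ : ∃ k, m = 6 + 4 * k + 4 := ⟨(m - 10) / 4, by omega⟩
    exact cubicPowerSum_ne_zero_of_stride 6 64 0 121 2065 (by norm_num)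
      (by norm_num [cubicPowerSum]) (by norm_num [cubicPowerSum]) (by norm_num [cubicPowerSum]) k
  · obtain ⟨k, rfl⟩ : ∃ k, m = 3 + 4 * k + 4 := ⟨(m - 7) / 4, by omega⟩
    exact cubicPowerSum_ne_zero_of_stride 3 4 (-9) (-95) (-446) (by norm_num)
      (by norm_num [cubicPowerSum]) (by norm_num [cubicPowerSum]) (by norm_num [cubicPowerSum]) k

/-- If `e₁ = 0`, `e₂ = 6 c²` and `e₃ = -12 c³`, the power sums are `c ^ k * cubicPowerSum k`. -/
lemma pow_sum_eq_cubicPowerSum {x y z c : ℂ} (h1 : x + y + z = 0)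
    (h2 : x * y + y * z + z * x = 6 * c ^ 2) (h3 : x * y * z = -12 * c ^ 3) (k : ℕ) :
    x ^ k + y ^ k + z ^ k = c ^ k * cubicPowerSum k := by
  induction k using cubicPowerSum.induct with
  | case1 => norm_num [cubicPowerSum]
  | case2 => simpa [cubicPowerSum] using h1
  | case3 =>
    norm_num [cubicPowerSum]
    linear_combination (x + y + z) * h1 - 2 * h2
  | case4 k ih1 ih0 =>
    rw [Nat.succ_eq_add_one, show (k + 1 + 1 + 1 : ℕ) = k + 3 from rfl, cubicPowerSum_add_three]
    push_cast
    linear_combination (x ^ (k + 2) + y ^ (k + 2) + z ^ (k + 2)) * h1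
      - (x ^ (k + 1) + y ^ (k + 1) + z ^ (k + 1)) * h2 + (x ^ k + y ^ k + z ^ k) * h3
      - 6 * c ^ 2 * ih1 - 12 * c ^ 3 * ih0

lemma eq_zero_of_pow_six_sum_eq_zero {x y z : ℂ} {m : ℕ} (h1 : x + y + z = 0)
    (h : x ^ 6 + y ^ 6 + z ^ 6 = 0) (hm1 : m ≠ 1) (hm6 : m ≠ 6)
    (hm : x ^ m + y ^ m + z ^ m = 0) : x = 0 ∧ y = 0 ∧ z = 0 := by
  have h6 : 2 * (x * y + y * z + z * x) ^ 3 = 3 * (x * y * z) ^ 2 := by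
    obtain rfl : z = -x - y := by linear_combination h1
    linear_combination -h
  by_cases h2 : x * y + y * z + z * x = 0
  · exact eq_zero_of_esymm_two_eq_zero (m := 6) h1 h2 (by norm_num) h
  obtain ⟨c, hc⟩ : ∃ c, c = -(x * y * z) / (2 * (x * y + y * z + z * x)) := ⟨_, rfl⟩
  set a := x * y + y * z + z * x with ha
  have hb : x * y * z = -2 * a * c := by rw [hc]; field_simp
  have hac : a = 6 * c ^ 2 := by
    rw [hb] at h6
    refine mul_left_cancel₀ (pow_ne_zero 2 h2) ?_
    linear_combination h6 / 2
  have hc0 : c ≠ 0 := by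
    rintro rfl
    simp [hac] at h2
  rw [pow_sum_eq_cubicPowerSum h1 (ha ▸ hac) (by rw [hb, hac]; ring)] at hm
  exact absurd hm (mul_ne_zero (pow_ne_zero m hc0)
    (Int.cast_ne_zero.2 (cubicPowerSum_ne_zero hm1 hm6)))

/-- Let `n` and `m` be positive integers with `2 ≤ n ≤ 7`, `m ∉ {1, n}`, and
`6 ∣ n·m`. Then the power sums `p₁(3), p_n(3), p_m(3)` have no common zero in `ℂ³` other
than the origin. -/
theorem stmt12 (n m : ℕ) (hn2 : 2 ≤ n) (hn7 : n ≤ 7) (hm : 0 < m) (hm1 : m ≠ 1)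
    (hmn : m ≠ n) (hdvd : 6 ∣ n * m) :
    ∀ x y z : ℂ, x + y + z = 0 → x ^ n + y ^ n + z ^ n = 0 →
      x ^ m + y ^ m + z ^ m = 0 → x = 0 ∧ y = 0 ∧ z = 0 := by
  intro x y z h1 hn h
  obtain rfl : z = -x - y := by linear_combination h1
  set z := -x - y with hz
  have of_e2 (h2 : x * y + y * z + z * x = 0) (h3 : 3 ∣ m) : x = 0 ∧ y = 0 ∧ z = 0 :=
    eq_zero_of_esymm_two_eq_zero h1 h2 h3 h
  have of_e3 (h3 : x * y * z = 0) (h2 : 2 ∣ m) : x = 0 ∧ y = 0 ∧ z = 0 :=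
    eq_zero_of_esymm_three_eq_zero h1 h3 hm.ne' (even_iff_two_dvd.2 h2) h
  interval_cases n
  · exact of_e2 (by rw [hz] at *; linear_combination -hn / 2) (by omega)
  · exact of_e3 (by rw [hz] at *; linear_combination hn / 3) (by omega)
  · refine of_e2 (eq_zero_of_pow_eq_zero (n := 2) ?_) (by omega)
    rw [hz] at *
    linear_combination hn / 2
  · have h0 : (x * y + y * z + z * x) * (x * y * z) = 0 := by
      rw [hz] at *
      linear_combination -hn / 5
    exact (mul_eq_zero.1 h0).elim (of_e2 · (by omega)) (of_e3 · (by omega))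
  · exact eq_zero_of_pow_six_sum_eq_zero h1 hn hm1 hmn h
  · have h0 : (x * y + y * z + z * x) ^ 2 * (x * y * z) = 0 := by
      rw [hz] at *
      linear_combination hn / 7
    exact (mul_eq_zero.1 h0).elim (fun h2 => of_e2 (eq_zero_of_pow_eq_zero h2) (by omega))
      (of_e3 · (by omega))
end

section
/- Let d be an integer with d > 3. Then the power sums p_2(3), p_3(3), p_d(3) have no common zero in ℂ^3 other than the origin; that is, they form a regular sequence in ℂ[x_1,x_2,x_3]. -/
/-- If the power sums of degrees `2` and `3` vanish, then the power sums
satisfy a three-term linear recurrence with coefficients in `x + y + z`. -/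
theorem power_sum_recurrence {x y z : ℂ} (h2 : x ^ 2 + y ^ 2 + z ^ 2 = 0)
    (h3 : x ^ 3 + y ^ 3 + z ^ 3 = 0) (n : ℕ) :
    6 * (x ^ (n + 3) + y ^ (n + 3) + z ^ (n + 3)) =
      6 * (x + y + z) * (x ^ (n + 2) + y ^ (n + 2) + z ^ (n + 2))
        - 3 * (x + y + z) ^ 2 * (x ^ (n + 1) + y ^ (n + 1) + z ^ (n + 1))
        + (x + y + z) ^ 3 * (x ^ n + y ^ n + z ^ n) := by
  have e2 : (x + y + z) ^ 2 = 2 * (x * y + y * z + z * x) := by linear_combination h2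
  have e3 : (x + y + z) ^ 3 = 6 * (x * y * z) := by
    linear_combination 3 * (x + y + z) * h2 - 2 * h3
  rw [e2, e3]
  ring

/-- After clearing denominators, the power sums of degree at least `4` are odd integer multiples
of powers of `x + y + z`. -/
theorem exists_odd_power_sum {x y z : ℂ} (h2 : x ^ 2 + y ^ 2 + z ^ 2 = 0)
    (h3 : x ^ 3 + y ^ 3 + z ^ 3 = 0) (m : ℕ) :
    ∃ a b c : ℤ, Odd a ∧ Odd b ∧
      6 ^ (m + 1) * (x ^ (2 * m + 4) + y ^ (2 * m + 4) + z ^ (2 * m + 4)) =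
        a * (x + y + z) ^ (2 * m + 4) ∧
      6 ^ (m + 1) * (x ^ (2 * m + 5) + y ^ (2 * m + 5) + z ^ (2 * m + 5)) =
        b * (x + y + z) ^ (2 * m + 5) ∧
      6 ^ m * (x ^ (2 * m + 3) + y ^ (2 * m + 3) + z ^ (2 * m + 3)) =
        c * (x + y + z) ^ (2 * m + 3) := by
  have hrec := power_sum_recurrence h2 h3
  induction m with
  | zero =>
    have r1 := hrec 1
    have r2 := hrec 2
    norm_num at r1 r2
    refine ⟨1, 1, 0, odd_one, odd_one, ?_, ?_, ?_⟩
    · norm_num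
      linear_combination r1 + 6 * (x + y + z) * h3 - 3 * (x + y + z) ^ 2 * h2
    · norm_num
      linear_combination r2 + (x + y + z) * r1 + (6 * (x + y + z) ^ 2 - 3 * (x + y + z) ^ 2) * h3
        - 3 * (x + y + z) ^ 3 * h2 + (x + y + z) ^ 3 * h2
    · norm_num
      exact h3
  | succ m ih =>
    obtain ⟨a, b, c, ha, hb, h4, h5, h6⟩ := ih
    have r1 := hrec (2 * m + 3)
    have r2 := hrec (2 * m + 4)
    have k4 : 6 ^ (m + 2) * (x ^ (2 * m + 6) + y ^ (2 * m + 6) + z ^ (2 * m + 6)) =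
        ((6 * b - 3 * a + 6 * c : ℤ) : ℂ) * (x + y + z) ^ (2 * m + 6) := by
      push_cast
      linear_combination 6 ^ (m + 1) * r1 + 6 * (x + y + z) * h5 - 3 * (x + y + z) ^ 2 * h4
        + 6 * (x + y + z) ^ 3 * h6
    refine ⟨6 * b - 3 * a + 6 * c, 6 * b - 3 * a + 6 * c - 3 * b + a, b, ?_, ?_, k4, ?_, h5⟩
    · grind
    · grind
    · push_cast at k4 ⊢
      linear_combination 6 ^ (m + 1) * r2 + (x + y + z) * k4 - 3 * (x + y + z) ^ 2 * h5
        + (x + y + z) ^ 3 * h4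

/-- Let `d > 3` be an integer. Then the power sums `p₂(3), p₃(3), p_d(3)`
have no common zero in `ℂ³` other than the origin. -/
theorem stmt13 (d : ℕ) (hd : 3 < d) :
    ∀ x y z : ℂ, x ^ 2 + y ^ 2 + z ^ 2 = 0 → x ^ 3 + y ^ 3 + z ^ 3 = 0 →
      x ^ d + y ^ d + z ^ d = 0 → x = 0 ∧ y = 0 ∧ z = 0 := by
  intro x y z h2 h3 h
  have he : x + y + z = 0 := by
    obtain ⟨a, b, _, ha, hb, h4, h5, -⟩ := exists_odd_power_sum h2 h3 ((d - 4) / 2)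
    have ha0 : (a : ℂ) ≠ 0 := by
      exact_mod_cast (by grind : a ≠ 0)
    have hb0 : (b : ℂ) ≠ 0 := by
      exact_mod_cast (by grind : b ≠ 0)
    rcases (by omega : 2 * ((d - 4) / 2) + 4 = d ∨ 2 * ((d - 4) / 2) + 5 = d) with hd' | hd'
    · rw [hd', h, mul_zero] at h4
      exact eq_zero_of_pow_eq_zero ((mul_eq_zero.mp h4.symm).resolve_left ha0)
    · rw [hd', h, mul_zero] at h5
      exact eq_zero_of_pow_eq_zero ((mul_eq_zero.mp h5.symm).resolve_left hb0)
  have key : ∀ t : ℂ, (t - x) * (t - y) * (t - z) = t ^ 3 := fun t => by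
    linear_combination (-t ^ 2 + t * (x + y + z) / 2 - (x + y + z) ^ 2 / 6) * he
      + (-t / 2 + (x + y + z) / 2) * h2 - h3 / 3
  refine ⟨?_, ?_, ?_⟩
  · exact eq_zero_of_pow_eq_zero (n := 3) (by rw [← key]; ring)
  · exact eq_zero_of_pow_eq_zero (n := 3) (by rw [← key]; ring)
  · exact eq_zero_of_pow_eq_zero (n := 3) (by rw [← key]; ring)
end

section
/- Let t ∈ {2, 3, 4, 5, 7}, and let a, b be positive integers such that GCD(a, a·t, b) = 1 and 6 divides a·(a·t)·b. Then the power sums p_a(3), p_{a·t}(3), p_b(3) have no common zero in ℂ^3 other than the origin; that is, they form a regular sequence in ℂ[x_1,x_2,x_3]. -/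
/-- In a field, two elements with equal `a`-th and equal `b`-th powers, `a` and `b` coprime,
are equal. -/
theorem eq_of_pow_eq_pow_of_coprime {K : Type*} [Field K] {a b : ℕ} (ha : 0 < a)
    (hab : Nat.Coprime a b) {x y : K} (h₁ : x ^ a = y ^ a) (h₂ : x ^ b = y ^ b) : x = y := by
  by_cases hy : y = 0
  · subst hy
    rw [zero_pow ha.ne'] at h₁
    exact eq_zero_of_pow_eq_zero h₁
  · have ha' : (x / y) ^ a = 1 := by rw [div_pow, h₁, div_self (pow_ne_zero _ hy)]
    have hb' : (x / y) ^ b = 1 := by rw [div_pow, h₂, div_self (pow_ne_zero _ hy)]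
    have h := pow_gcd_eq_one.mpr ⟨ha', hb'⟩
    rw [hab.gcd_eq_one, pow_one] at h
    exact (div_eq_one_iff_eq hy).mp h

/-- If `A + B + C = 0` with `A`, `B`, `C` of equal norm, then `A B + B C + C A = 0`. -/
theorem mul_add_mul_add_mul_eq_zero_of_norm_eq {A B C : ℂ} (h : A + B + C = 0)
    (hA : ‖A‖ = ‖C‖) (hB : ‖B‖ = ‖C‖) : A * B + B * C + C * A = 0 := by
  have hC' := Complex.mul_conj' C
  have hA' := Complex.mul_conj' A
  have hB' := Complex.mul_conj' B
  rw [hA] at hA'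
  rw [hB] at hB'
  have hconj := congrArg (starRingEnd ℂ) h
  simp only [map_add, map_zero] at hconj
  have key : (‖C‖ : ℂ) ^ 2 * (A * B + B * C + C * A) = 0 := by
    linear_combination A * B * C * hconj - B * C * hA' - A * C * hB' - A * B * hC'
  rcases mul_eq_zero.mp key with h0 | h0
  · have hC0 : ‖C‖ = 0 := by exact_mod_cast eq_zero_of_pow_eq_zero h0
    rw [hC0] at hA hB
    simp [norm_eq_zero.mp hA, norm_eq_zero.mp hB]
  · exact h0

theorem pow_three_eq_of_esymm_eq_zero {R : Type*} [CommRing R] {A B C : R} (h₁ : A + B + C = 0)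
    (h₂ : A * B + B * C + C * A = 0) : A ^ 3 = C ^ 3 := by
  linear_combination (A - C) * ((A + C) * h₁ - h₂)

theorem eq_zero_of_pow_sum_eq_zero_of_esymm_two_eq_zero {a b : ℕ} (ha : 0 < a)
    (hab : Nat.Coprime a b) (h3 : 3 ∣ a * b) {x y z : ℂ} (h₁ : x ^ a + y ^ a + z ^ a = 0)
    (h₂ : x ^ a * y ^ a + y ^ a * z ^ a + z ^ a * x ^ a = 0) (h₃ : x ^ b + y ^ b + z ^ b = 0) :
    x = 0 ∧ y = 0 ∧ z = 0 := by
  have hxa := pow_three_eq_of_esymm_eq_zero h₁ h₂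
  have hya : (y ^ a) ^ 3 = (z ^ a) ^ 3 :=
    pow_three_eq_of_esymm_eq_zero (B := x ^ a) (by linear_combination h₁)
      (by linear_combination h₂)
  have norm_eq {u v : ℂ} (h : (u ^ a) ^ 3 = (v ^ a) ^ 3) : ‖u‖ = ‖v‖ := by
    have h' := congrArg norm h
    simp only [norm_pow, ← pow_mul] at h'
    exact (pow_left_inj₀ (norm_nonneg _) (norm_nonneg _) (by positivity)).mp h'
  have h₄ := mul_add_mul_add_mul_eq_zero_of_norm_eq h₃
    (by rw [norm_pow, norm_pow, norm_eq hxa]) (by rw [norm_pow, norm_pow, norm_eq hya])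
  have hxb := pow_three_eq_of_esymm_eq_zero h₃ h₄
  have hyb : (y ^ b) ^ 3 = (z ^ b) ^ 3 :=
    pow_three_eq_of_esymm_eq_zero (B := x ^ b) (by linear_combination h₃)
      (by linear_combination h₄)
  have hx : x ^ 3 = z ^ 3 := eq_of_pow_eq_pow_of_coprime ha hab
    (by rw [pow_right_comm, hxa, pow_right_comm]) (by rw [pow_right_comm, hxb, pow_right_comm])
  have hy : y ^ 3 = z ^ 3 := eq_of_pow_eq_pow_of_coprime ha hab
    (by rw [pow_right_comm, hya, pow_right_comm]) (by rw [pow_right_comm, hyb, pow_right_comm])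
  have of_dvd {c : ℕ} (hc : 3 ∣ c) (h : x ^ c + y ^ c + z ^ c = 0) : z = 0 := by
    obtain ⟨k, rfl⟩ := hc
    rw [pow_mul, pow_mul, hx, hy, ← pow_mul] at h
    have h' : z ^ (3 * k) = 0 := by linear_combination h / 3
    exact eq_zero_of_pow_eq_zero h'
  have hz : z = 0 := (Nat.prime_three.dvd_mul.mp h3).elim (of_dvd · h₁) (of_dvd · h₃)
  subst hz
  rw [zero_pow three_ne_zero] at hx hy
  exact ⟨eq_zero_of_pow_eq_zero hx, eq_zero_of_pow_eq_zero hy, rfl⟩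

theorem eq_zero_of_pow_add_pow_eq_zero_s15 {K : Type*} [Field K] [NeZero (2 : K)] {a b : ℕ}
    (ha : 0 < a) (hab : Nat.Coprime a b) (h2 : 2 ∣ a * b) {x y : K}
    (h₁ : x ^ a + y ^ a = 0) (h₂ : x ^ b + y ^ b = 0) : x = 0 ∧ y = 0 := by
  have hsq : x ^ 2 = y ^ 2 := eq_of_pow_eq_pow_of_coprime ha hab
    (by rw [pow_right_comm, pow_right_comm y]; linear_combination (x ^ a - y ^ a) * h₁)
    (by rw [pow_right_comm, pow_right_comm y]; linear_combination (x ^ b - y ^ b) * h₂)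
  have of_dvd {c : ℕ} (hc : 2 ∣ c) (h : x ^ c + y ^ c = 0) : y = 0 := by
    obtain ⟨k, rfl⟩ := hc
    rw [pow_mul, hsq, ← pow_mul, ← two_mul] at h
    exact eq_zero_of_pow_eq_zero ((mul_eq_zero.mp h).resolve_left two_ne_zero)
  have hy : y = 0 := (Nat.prime_two.dvd_mul.mp h2).elim (of_dvd · h₁) (of_dvd · h₂)
  subst hy
  rw [zero_pow two_ne_zero] at hsq
  exact ⟨eq_zero_of_pow_eq_zero hsq, rfl⟩

theorem eq_zero_of_pow_sum_eq_zero_of_mul_eq_zero {K : Type*} [Field K] [NeZero (2 : K)]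
    {a b : ℕ} (ha : 0 < a) (hb : 0 < b) (hab : Nat.Coprime a b) (h2 : 2 ∣ a * b) {x y z : K}
    (h₁ : x ^ a + y ^ a + z ^ a = 0) (h₂ : x ^ a * y ^ a * z ^ a = 0)
    (h₃ : x ^ b + y ^ b + z ^ b = 0) : x = 0 ∧ y = 0 ∧ z = 0 := by
  simp only [mul_eq_zero, pow_eq_zero_iff ha.ne'] at h₂
  rcases h₂ with (rfl | rfl) | rfl <;>
    simp only [zero_pow ha.ne', zero_pow hb.ne', zero_add, add_zero] at h₁ h₃ <;>
    have := eq_zero_of_pow_add_pow_eq_zero_s15 ha hab h2 h₁ h₃ <;> tauto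


/-- Let `t ∈ {2, 3, 4, 5, 7}`, and let `a, b` be positive integers such that
`GCD(a, a·t, b) = 1` and `6 ∣ a·(a·t)·b`. Then the power sums `p_a(3), p_{a·t}(3), p_b(3)`
have no common zero in `ℂ³` other than the origin. -/
theorem stmt15 (t a b : ℕ) (ht : t ∈ ({2, 3, 4, 5, 7} : Finset ℕ))
    (ha : 0 < a) (hb : 0 < b)
    (hgcd : Nat.gcd a (Nat.gcd (a * t) b) = 1) (hdvd : 6 ∣ a * (a * t) * b) :
    ∀ x y z : ℂ, x ^ a + y ^ a + z ^ a = 0 →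
      x ^ (a * t) + y ^ (a * t) + z ^ (a * t) = 0 →
      x ^ b + y ^ b + z ^ b = 0 → x = 0 ∧ y = 0 ∧ z = 0 := by
  intro x y z h₁ h₂ h₃
  have hab : Nat.Coprime a b := by
    rwa [← Nat.gcd_assoc, Nat.gcd_eq_left (dvd_mul_right a t)] at hgcd
  have prime_dvd {p : ℕ} (hp : p.Prime) (h6 : p ∣ 6) (hpt : ¬ p ∣ t) : p ∣ a * b := by
    have := h6.trans hdvd
    simp only [hp.dvd_mul] at this ⊢
    tauto
  have of_e₂ := eq_zero_of_pow_sum_eq_zero_of_esymm_two_eq_zero ha hab (h₁ := h₁) (h₃ := h₃)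
  have of_e₃ := eq_zero_of_pow_sum_eq_zero_of_mul_eq_zero ha hb hab (h₁ := h₁) (h₃ := h₃)
  have hz : z ^ a = -x ^ a - y ^ a := by linear_combination h₁
  simp only [pow_mul] at h₂
  rw [hz] at of_e₂ of_e₃ h₂
  generalize x ^ a = X at *
  generalize y ^ a = Y at *
  simp only [Finset.mem_insert, Finset.mem_singleton] at ht
  rcases ht with rfl | rfl | rfl | rfl | rfl
  · exact of_e₂ (prime_dvd Nat.prime_three (by norm_num) (by norm_num))
      (by linear_combination -h₂ / 2)
  · exact of_e₃ (prime_dvd Nat.prime_two (by norm_num) (by norm_num))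
      (by linear_combination h₂ / 3)
  · refine of_e₂ (prime_dvd Nat.prime_three (by norm_num) (by norm_num))
      (pow_eq_zero_iff two_ne_zero |>.mp ?_)
    linear_combination h₂ / 2
  · have h : (X * Y + Y * (-X - Y) + (-X - Y) * X) * (X * Y * (-X - Y)) = 0 := by
      linear_combination -h₂ / 5
    exact (mul_eq_zero.mp h).elim
      (of_e₂ (prime_dvd Nat.prime_three (by norm_num) (by norm_num)))
      (of_e₃ (prime_dvd Nat.prime_two (by norm_num) (by norm_num)))
  · have h : (X * Y + Y * (-X - Y) + (-X - Y) * X) ^ 2 * (X * Y * (-X - Y)) = 0 := by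
      linear_combination h₂ / 7
    exact (mul_eq_zero.mp h).elim
      (fun h ↦ of_e₂ (prime_dvd Nat.prime_three (by norm_num) (by norm_num))
        (eq_zero_of_pow_eq_zero h))
      (of_e₃ (prime_dvd Nat.prime_two (by norm_num) (by norm_num)))
end

section
/- Let b = 3^u(3^v + 1) for integers u > 0 and v ≥ 0, and let f_b(x) = 1 + x^b + (−1)^b (x+1)^b ∈ ℚ[x]. Then f_b(x) is irreducible over ℚ. -/
open Polynomial

/-- Eisenstein's criterion over `ℤ` for a polynomial that need not be primitive. -/
theorem irreducible_map_of_isEisensteinAt {f : ℤ[X]} {p : ℤ} (hp : Prime p)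
    (hf : f.IsEisensteinAt (Ideal.span {p})) (hd : 0 < f.natDegree) :
    Irreducible (f.map (Int.castRingHom ℚ)) := by
  have hf0 : f ≠ 0 := by
    rintro rfl
    simp at hd
  have hc0 : f.content ≠ 0 := by simpa [content_eq_zero_iff] using hf0
  have hcoeff (n : ℕ) : f.coeff n = f.content * f.primPart.coeff n := by
    conv_lhs => rw [f.eq_C_content_mul_primPart, coeff_C_mul]
  have hlead : ¬ p ∣ f.content * f.primPart.leadingCoeff := by
    rw [leadingCoeff, natDegree_primPart, ← hcoeff]
    simpa [Ideal.mem_span_singleton] using hf.leading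
  have hc : ¬ p ∣ f.content := fun h => hlead (h.mul_right _)
  have hE : f.primPart.IsEisensteinAt (Ideal.span {p}) := by
    refine ⟨?_, fun {n} hn => ?_, fun h => ?_⟩
    · rw [Ideal.mem_span_singleton]
      exact fun h => hlead (h.mul_left _)
    · rw [natDegree_primPart] at hn
      have h := hf.mem hn
      rw [Ideal.mem_span_singleton, hcoeff] at h
      rw [Ideal.mem_span_singleton]
      exact (hp.dvd_or_dvd h).resolve_left hc
    · apply hf.notMem
      rw [hcoeff]
      exact Ideal.mul_mem_left _ _ h
  have hirr : Irreducible f.primPart :=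
    hE.irreducible ((Ideal.span_singleton_prime hp.ne_zero).2 hp) f.isPrimitive_primPart
      (by rwa [natDegree_primPart])
  rw [IsPrimitive.Int.irreducible_iff_irreducible_map_cast f.isPrimitive_primPart] at hirr
  rw [f.eq_C_content_mul_primPart, Polynomial.map_mul, map_C]
  have hu : IsUnit (C (Int.castRingHom ℚ f.content)) := by
    rw [isUnit_C, isUnit_iff_ne_zero]
    simpa using hc0
  exact (irreducible_isUnit_mul hu).2 hirr

theorem one_add_pow_add_pow_eq_of_charP_three {R : Type*} [CommRing R] [CharP R 3]
    (x : R) (u v : ℕ) :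
    1 + (x + 1) ^ (3 ^ u * (3 ^ v + 1)) + (x + 2) ^ (3 ^ u * (3 ^ v + 1)) =
      2 * x ^ (3 ^ u * (3 ^ v + 1)) := by
  have h3 : (3 : R) = 0 := by exact_mod_cast CharP.cast_eq_zero R 3
  have : Fact (Nat.Prime 3) := ⟨Nat.prime_three⟩
  have : ExpChar R 3 := ExpChar.prime Nat.prime_three
  have h2 : x + 2 = x - 1 := by linear_combination h3
  have key : 1 + (x + 1) ^ (3 ^ v + 1) + (x - 1) ^ (3 ^ v + 1) = 2 * x ^ (3 ^ v + 1) := by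
    rw [pow_succ (x + 1), pow_succ (x - 1), add_pow_char_pow, sub_pow_char_pow, one_pow]
    linear_combination h3
  have h2' : (2 : R) ^ 3 ^ u = 2 := by
    have : (2 : R) = -1 := by linear_combination h3
    rw [this, Odd.neg_one_pow (Odd.pow (by decide))]
  have hpow := congrArg (· ^ 3 ^ u) key
  simp only [add_pow_char_pow, mul_pow, one_pow, h2', ← pow_mul] at hpow
  rw [h2, mul_comm (3 ^ u)]
  exact hpow

theorem isEisensteinAt_one_add_pow_add_pow {u : ℕ} (hu : 0 < u) (v : ℕ) :
    ((1 : ℤ[X]) + (X + 1) ^ (3 ^ u * (3 ^ v + 1)) +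
      (X + 2) ^ (3 ^ u * (3 ^ v + 1))).IsEisensteinAt (Ideal.span {3}) ∧
    0 < ((1 : ℤ[X]) + (X + 1) ^ (3 ^ u * (3 ^ v + 1)) +
      (X + 2) ^ (3 ^ u * (3 ^ v + 1))).natDegree := by
  have hmod := one_add_pow_add_pow_eq_of_charP_three (X : (ZMod 3)[X]) u v
  have h6 : ∃ m, 3 ^ u * (3 ^ v + 1) = 6 * m := by
    obtain ⟨k, rfl⟩ := Nat.exists_eq_succ_of_ne_zero hu.ne'
    obtain ⟨c, hc⟩ : Even (3 ^ v + 1) := (Odd.pow (by decide)).add_one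
    exact ⟨3 ^ k * c, by rw [hc, Nat.succ_eq_add_one]; ring⟩
  have hb : 0 < 3 ^ u * (3 ^ v + 1) := by positivity
  generalize 3 ^ u * (3 ^ v + 1) = b at *
  set g : ℤ[X] := 1 + (X + 1) ^ b + (X + 2) ^ b with hg
  have hmap : g.map (Int.castRingHom (ZMod 3)) = C 2 * X ^ b := by
    rw [hg, C_ofNat]
    simpa using hmod
  have hcoeff (n : ℕ) : ((g.coeff n : ℤ) : ZMod 3) = if n = b then 2 else 0 := by
    have := congrArg (coeff · n) hmap
    simpa [coeff_X_pow] using this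
  have hle : g.natDegree ≤ b := by
    have h1 : (X + 1 : ℤ[X]).natDegree = 1 := natDegree_X_add_C 1
    have h2 : (X + 2 : ℤ[X]).natDegree = 1 := natDegree_X_add_C 2
    refine natDegree_add_le_of_degree_le (natDegree_add_le_of_degree_le (by simp) ?_) ?_
    · simp [h1]
    · simp [h2]
  have htop : ((g.coeff b : ℤ) : ZMod 3) ≠ 0 := by
    rw [hcoeff, if_pos rfl]
    decide
  have hdeg : g.natDegree = b :=
    le_antisymm hle (le_natDegree_of_ne_zero fun h => htop (by simp [h]))
  refine ⟨⟨?_, fun {n} hn => ?_, ?_⟩, hdeg ▸ hb⟩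
  · rw [Ideal.mem_span_singleton, leadingCoeff, hdeg]
    exact fun h => htop ((ZMod.intCast_zmod_eq_zero_iff_dvd _ 3).2 h)
  · rw [Ideal.mem_span_singleton]
    refine (ZMod.intCast_zmod_eq_zero_iff_dvd _ 3).1 ?_
    rw [hcoeff, if_neg (by omega)]
  · rw [Ideal.span_singleton_pow, Ideal.mem_span_singleton]
    intro h
    have h9 := (ZMod.intCast_zmod_eq_zero_iff_dvd _ 9).2 h
    obtain ⟨m, rfl⟩ := h6
    have h64 : (64 : ZMod 9) = 1 := by decide
    have h3 : (2 + 64 ^ m : ZMod 9) = 0 := by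
      simpa [hg, coeff_zero_eq_eval_zero, pow_mul] using h9
    rw [h64, one_pow] at h3
    exact absurd h3 (by decide)

/-- Let `b = 3^u(3^v + 1)` for integers `u > 0` and `v ≥ 0`, and let
`f_b(x) = 1 + x^b + (−1)^b (x+1)^b ∈ ℚ[x]`. Then `f_b` is irreducible over `ℚ`. -/
theorem stmt16 (u v b : ℕ) (hu : 0 < u) (hb : b = 3 ^ u * (3 ^ v + 1)) :
    Irreducible ((1 : ℚ[X]) + X ^ b + (-1) ^ b * (X + 1) ^ b) := by
  have heven : Even b := by
    rw [hb]
    exact ((Odd.pow (by decide)).add_one).mul_left _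
  obtain ⟨hE, hd⟩ := isEisensteinAt_one_add_pow_add_pow hu v
  have hirr := irreducible_map_of_isEisensteinAt Int.prime_three hE hd
  rw [← hb] at hirr
  rw [heven.neg_one_pow, one_mul, ← MulEquiv.irreducible_iff (algEquivAevalXAddC (1 : ℚ))]
  convert hirr using 1
  have h2 : (X + 1 + 1 : ℚ[X]) = X + 2 := by ring
  simp [h2]
end

section
/- Let a, b be positive integers with 1 < a < b and b = 3^u(3^v + 1) for some integers u > 0 and v ≥ 0. Then the power sums p_1(3), p_a(3), p_b(3) have no common zero in ℂ^3 other than the origin; that is, they form a regular sequence in ℂ[x_1,x_2,x_3]. -/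
open Polynomial

/-- Eisenstein's criterion over `ℚ` for integer polynomials that need not be primitive. -/
theorem irreducible_map_rat_of_eisenstein {f : ℤ[X]} {p : ℤ} (hp : Prime p)
    (hdeg : 0 < f.natDegree) (hlead : ¬ p ∣ f.leadingCoeff)
    (hcoeff : ∀ i < f.natDegree, p ∣ f.coeff i) (hzero : ¬ p ^ 2 ∣ f.coeff 0) :
    Irreducible (f.map (Int.castRingHom ℚ)) := by
  have hf : f ≠ 0 := by
    rintro rfl
    simp at hdeg
  have hc : ∀ i, f.coeff i = f.content * f.primPart.coeff i := fun i => by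
    conv_lhs => rw [f.eq_C_content_mul_primPart, coeff_C_mul]
  have hpc : ¬ p ∣ f.content := fun h => hlead (h.trans (content_dvd_coeff _))
  have hirr : Irreducible f.primPart := by
    refine irreducible_of_eisenstein_criterion (P := Ideal.span {p})
      ((Ideal.span_singleton_prime hp.ne_zero).2 hp) ?_ ?_ ?_ ?_ f.isPrimitive_primPart
    · rw [Ideal.mem_span_singleton]
      intro h
      apply hlead
      rw [leadingCoeff, hc, ← natDegree_primPart]
      exact h.mul_left _
    · intro i hi
      rw [Ideal.mem_span_singleton]
      have hi' : i < f.natDegree := by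
        rw [← natDegree_primPart]
        exact coe_lt_degree.1 hi
      exact (hp.dvd_or_dvd (hc i ▸ hcoeff i hi')).resolve_left hpc
    · rw [← natDegree_pos_iff_degree_pos, natDegree_primPart]
      exact hdeg
    · rw [Ideal.span_singleton_pow, Ideal.mem_span_singleton]
      exact fun h => hzero (hc 0 ▸ h.mul_left _)
  have hmap := (IsPrimitive.Int.irreducible_iff_irreducible_map_cast
    f.isPrimitive_primPart).1 hirr
  rw [f.eq_C_content_mul_primPart, Polynomial.map_mul, map_C]
  refine (irreducible_isUnit_mul (isUnit_C.2 ?_)).2 hmap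
  simpa [content_eq_zero_iff] using hf

/-- The sum of `b`-th powers at `(1 + X, -2 - X, 1)` for even `b`. -/
noncomputable def shiftedPowerSum (b : ℕ) : ℤ[X] := (X + 1) ^ b + (X + 2) ^ b + 1

theorem shiftedPowerSum_map_zmod_three (u v : ℕ) :
    (shiftedPowerSum (3 ^ u * (3 ^ v + 1))).map (Int.castRingHom (ZMod 3)) =
      C (2 ^ 3 ^ u) * X ^ (3 ^ u * (3 ^ v + 1)) := by
  have h3 : (3 : (ZMod 3)[X]) = 0 := CharP.cast_eq_zero (ZMod 3)[X] 3
  have h2 : (X + 2 : (ZMod 3)[X]) = X - 1 := by linear_combination h3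
  have key : ((X : (ZMod 3)[X]) + 1) ^ (3 ^ v + 1) + (X - 1) ^ (3 ^ v + 1) + 1 =
      2 * X ^ (3 ^ v + 1) := by
    rw [pow_succ, pow_succ, pow_succ, add_pow_char_pow, sub_pow_char_pow, one_pow]
    linear_combination h3
  calc _ = ((X : (ZMod 3)[X]) + 1) ^ (3 ^ u * (3 ^ v + 1)) +
        (X - 1) ^ (3 ^ u * (3 ^ v + 1)) + 1 := by
        simp [shiftedPowerSum, h2]
    _ = (((X : (ZMod 3)[X]) + 1) ^ (3 ^ v + 1) + (X - 1) ^ (3 ^ v + 1) + 1) ^ 3 ^ u := by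
        rw [add_pow_char_pow, add_pow_char_pow, one_pow, ← pow_mul, ← pow_mul,
          mul_comm (3 ^ u)]
    _ = _ := by
        rw [key, mul_pow, ← pow_mul, mul_comm (3 ^ u), C_pow]
        rfl

theorem natDegree_shiftedPowerSum_le (b : ℕ) : (shiftedPowerSum b).natDegree ≤ b := by
  unfold shiftedPowerSum
  compute_degree

theorem six_dvd_three_pow_mul {u : ℕ} (hu : 0 < u) (v : ℕ) : 6 ∣ 3 ^ u * (3 ^ v + 1) := by
  have h2 : 2 ∣ 3 ^ v + 1 := ((Odd.pow (by decide : Odd 3)).add_one).two_dvd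
  exact mul_dvd_mul (dvd_pow_self 3 hu.ne') h2

theorem irreducible_shiftedPowerSum {u : ℕ} (hu : 0 < u) (v : ℕ) :
    (shiftedPowerSum (3 ^ u * (3 ^ v + 1))).natDegree = 3 ^ u * (3 ^ v + 1) ∧
    Irreducible ((shiftedPowerSum (3 ^ u * (3 ^ v + 1))).map (Int.castRingHom ℚ)) := by
  obtain ⟨k, hk⟩ := six_dvd_three_pow_mul hu v
  have hmap := shiftedPowerSum_map_zmod_three u v
  have hpos : 0 < 3 ^ u * (3 ^ v + 1) := by positivity
  set b := 3 ^ u * (3 ^ v + 1) with hb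
  have hcoeff (i : ℕ) : (3 : ℤ) ∣ (shiftedPowerSum b).coeff i ↔ i ≠ b := by
    have h := congrArg (coeff · i) hmap
    simp only [coeff_map, coeff_C_mul, coeff_X_pow, eq_intCast] at h
    rw [← Nat.cast_ofNat (R := ℤ), ← ZMod.intCast_zmod_eq_zero_iff_dvd, h]
    have h20 : (2 : ZMod 3) ≠ 0 := by decide
    simp [h20]
  have hlead : ¬ (3 : ℤ) ∣ (shiftedPowerSum b).coeff b := by simp [hcoeff]
  have hdeg : (shiftedPowerSum b).natDegree = b :=
    le_antisymm (natDegree_shiftedPowerSum_le b)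
      (le_natDegree_of_ne_zero fun h => hlead (h ▸ dvd_zero _))
  refine ⟨hdeg, irreducible_map_rat_of_eisenstein Int.prime_three (hpos.trans_eq hdeg.symm) ?_ ?_ ?_⟩
  · rwa [leadingCoeff, hdeg]
  · intro i hi
    exact (hcoeff i).2 (hi.trans_eq hdeg).ne
  · have h0 : (shiftedPowerSum b).coeff 0 = 64 ^ k + 2 := by
      rw [coeff_zero_eq_eval_zero, shiftedPowerSum, hk]
      simp [pow_mul]
      ring
    have h64 : (64 : ℤ) ^ k ≡ 1 ^ k [ZMOD 9] := Int.ModEq.pow k (by decide)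
    rw [one_pow] at h64
    rw [h0]
    unfold Int.ModEq at h64
    omega

theorem two_add_neg_two_pow_ne_zero {a : ℕ} (ha : 1 < a) : (2 + (-2) ^ a : ℚ) ≠ 0 := by
  obtain ⟨n, rfl⟩ := Nat.exists_eq_add_of_lt ha
  intro h
  have h' : (2 + (-2) ^ (1 + n + 1) : ℤ) = 0 := by exact_mod_cast h
  have : (2 : ℤ) + 4 * (-2) ^ n = 0 := by rw [← h']; ring
  omega

/-- Let `a, b` be positive integers with `1 < a < b` and
`b = 3^u(3^v + 1)` for some integers `u > 0`, `v ≥ 0`. Then the power sums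
`p₁(3), p_a(3), p_b(3)` have no common zero in `ℂ³` other than the origin. -/
theorem stmt17 (a b : ℕ) (ha : 1 < a) (hab : a < b)
    (hb : ∃ u v : ℕ, 0 < u ∧ b = 3 ^ u * (3 ^ v + 1)) :
    ∀ x y z : ℂ, x + y + z = 0 → x ^ a + y ^ a + z ^ a = 0 →
      x ^ b + y ^ b + z ^ b = 0 → x = 0 ∧ y = 0 ∧ z = 0 := by
  obtain ⟨u, v, hu, rfl⟩ := hb
  intro x y z h1 h2 h3
  obtain ⟨hdeg, hirr⟩ := irreducible_shiftedPowerSum hu v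
  have heven : Even (3 ^ u * (3 ^ v + 1)) :=
    even_iff_two_dvd.2 ((by decide : 2 ∣ 6).trans (six_dvd_three_pow_mul hu v))
  have hb0 : 3 ^ u * (3 ^ v + 1) ≠ 0 := by positivity
  set b := 3 ^ u * (3 ^ v + 1)
  by_cases hz : z = 0
  · subst hz
    have hy : y = -x := by linear_combination h1
    rw [hy, heven.neg_pow, zero_pow hb0] at h3
    have hx : x = 0 := pow_eq_zero_iff hb0 |>.1 (by linear_combination h3 / 2)
    simp [hy, hx]
  exfalso
  have hyz : y / z = -(x / z - 1) - 2 := by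
    field_simp
    linear_combination h1
  have hscale (n : ℕ) (h : x ^ n + y ^ n + z ^ n = 0) :
      (x / z) ^ n + (y / z) ^ n + 1 = 0 := by
    rw [div_pow, div_pow]
    field_simp
    rw [h, mul_zero]
  have hfb : aeval (x / z - 1) ((shiftedPowerSum b).map (Int.castRingHom ℚ)) = 0 := by
    have h := hscale b h3
    rw [← heven.neg_pow (y / z), hyz] at h
    simp only [shiftedPowerSum, Polynomial.map_add, Polynomial.map_pow, map_X, Polynomial.map_one,
      Polynomial.map_ofNat, map_add, map_pow, aeval_X, map_one, map_ofNat]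
    rw [← h]
    ring
  let g : ℚ[X] := (X + 1) ^ a + (-X - 2) ^ a + 1
  have hga : aeval (x / z - 1) g = 0 := by
    have h := hscale a h2
    rw [hyz] at h
    simp only [g, map_add, map_sub, map_neg, map_pow, aeval_X, map_one, map_ofNat]
    rw [← h]
    ring
  have hgdeg : g.natDegree ≤ a := by
    simp only [g]
    compute_degree
  have hg0 : g ≠ 0 := by
    intro h
    have h' := congrArg (eval 0) h
    simp only [g, eval_add, eval_sub, eval_neg, eval_pow, eval_X, eval_one, eval_ofNat,
      eval_zero] at h'
    apply two_add_neg_two_pow_ne_zero ha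
    rw [← h']
    norm_num
    ring
  rcases (dvd_or_isCoprime _ g hirr).symm with hcop | hdvd
  · obtain ⟨r, s, hrs⟩ := hcop
    have h := congrArg (aeval (x / z - 1)) hrs
    simp [hfb, hga] at h
  · have h := natDegree_le_of_dvd hdvd hg0
    rw [natDegree_map_eq_of_injective (Int.castRingHom ℚ).injective_int, hdeg] at h
    omega
end

section
/- For every positive integer d, the power sum p_{5d}(4) lies in the ideal of ℂ[x_1,x_2,x_3,x_4] generated by p_d(4) and p_{2d}(4). -/
open MvPolynomial

/-- Over a commutative ring in which `2` is invertible, the fifth power sum of four elements lies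
in the ideal generated by the first two power sums, by Newton's identities. -/
theorem sum_pow_five_mem_span_pair {R : Type*} [CommRing R] (h : R) (hh : 2 * h = 1)
    (y : Fin 4 → R) :
    ∑ i, y i ^ 5 ∈ Ideal.span {∑ i, y i, ∑ i, y i ^ 2} := by
  rw [Ideal.mem_span_pair]
  simp only [Fin.sum_univ_four]
  generalize y 0 = a, y 1 = b, y 2 = c, y 3 = e
  refine ⟨(a ^ 4 + b ^ 4 + c ^ 4 + e ^ 4) - h * (a + b + c + e) * (a ^ 3 + b ^ 3 + c ^ 3 + e ^ 3)
      - a * b * c * e,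
    h * (a ^ 3 + b ^ 3 + c ^ 3 + e ^ 3) + (a * b * c + a * b * e + a * c * e + b * c * e), ?_⟩
  linear_combination -(a * b + a * c + a * e + b * c + b * e + c * e) *
    (a ^ 3 + b ^ 3 + c ^ 3 + e ^ 3) * hh

/-- For every positive integer `d`, the power sum `p_{5d}(4)` lies in the
ideal of `ℂ[x₁,x₂,x₃,x₄]` generated by `p_d(4)` and `p_{2d}(4)`. -/
theorem stmt18 (d : ℕ) (hd : 0 < d) :
    (∑ i : Fin 4, (X i : MvPolynomial (Fin 4) ℂ) ^ (5 * d)) ∈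
      Ideal.span {∑ i : Fin 4, (X i : MvPolynomial (Fin 4) ℂ) ^ d,
        ∑ i : Fin 4, (X i : MvPolynomial (Fin 4) ℂ) ^ (2 * d)} := by
  have two_mul_half : (2 : MvPolynomial (Fin 4) ℂ) * C (1 / 2) = 1 := by
    rw [← map_ofNat (C : ℂ →+* MvPolynomial (Fin 4) ℂ) 2, ← C_mul]
    norm_num
  simpa only [← pow_mul, mul_comm d] using
    sum_pow_five_mem_span_pair _ two_mul_half fun i => (X i : MvPolynomial (Fin 4) ℂ) ^ d
end

section
/- For every integer h with h ≥ 1 and h ≠ 3, the rational number ∑_{b=0}^{⌊h/3⌋} ((−1)^{h−b}/(h−b)) · C(h−b, 2b) · (2/3)^b is non-zero, where C(m,n) denotes the binomial coefficient. -/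
/-- The integer `(2 (m + b) / m) * C(m, 2b)`, for `m ≠ 0`. -/
def weightedChoose (m : ℕ) : ℕ → ℤ
  | 0 => 2
  | b + 1 => 2 * m.choose (2 * b + 2) + (m - 1).choose (2 * b + 1)

lemma mul_weightedChoose (m b : ℕ) :
    (m : ℤ) * weightedChoose m b = 2 * (m + b) * m.choose (2 * b) := by
  rcases b with _ | b
  · simp [weightedChoose, mul_comm]
  rcases m with _ | m
  · simp [mul_add]
  have h : ((m + 1 : ℕ) : ℤ) * m.choose (2 * b + 1) =
      (m + 1).choose (2 * b + 2) * (2 * b + 2 : ℕ) := by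
    exact_mod_cast Nat.add_one_mul_choose_eq m (2 * b + 1)
  simp only [weightedChoose, Nat.add_sub_cancel, mul_add, mul_one]
  push_cast at h ⊢
  linear_combination h

lemma weightedChoose_eq_zero {m b : ℕ} (hb : b ≠ 0) (h : m < 2 * b) :
    weightedChoose m b = 0 := by
  obtain ⟨b, rfl⟩ := Nat.exists_eq_succ_of_ne_zero hb
  simp only [weightedChoose]
  rw [Nat.choose_eq_zero_of_lt (by omega), Nat.choose_eq_zero_of_lt (by omega)]
  simp

lemma weightedChoose_add_two (m b : ℕ) (h : m + b ≠ 0) :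
    weightedChoose (m + 2) (b + 1) =
      2 * weightedChoose (m + 1) (b + 1) - weightedChoose m (b + 1) + weightedChoose m b := by
  rcases m with _ | m
  · rw [weightedChoose_eq_zero, weightedChoose_eq_zero, weightedChoose_eq_zero,
      weightedChoose_eq_zero] <;> omega
  rcases b with _ | b
  · simp [weightedChoose, Nat.choose_succ_succ]
    ring
  · simp only [weightedChoose, Nat.add_sub_cancel, mul_add, mul_one, Nat.choose_succ_succ,
      Nat.add_succ_sub_one, Nat.succ_eq_add_one]
    push_cast
    ring

/-- The `b`-th term of the sum, cleared of denominators. -/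
def scaledTerm (h b : ℕ) : ℤ := (-3) ^ (h - b) * 2 ^ b * weightedChoose (h - b) b

lemma scaledTerm_eq_zero {h b : ℕ} (hb : b ≠ 0) (hh : h < 3 * b) : scaledTerm h b = 0 := by
  rw [scaledTerm, weightedChoose_eq_zero hb (by omega), mul_zero]

lemma scaledTerm_add_four (h b : ℕ) :
    scaledTerm (h + 4) (b + 1) =
      -6 * scaledTerm (h + 3) (b + 1) - 9 * scaledTerm (h + 2) (b + 1)
        + 18 * scaledTerm (h + 1) b := by
  rcases le_or_gt b (h + 1) with hb | hb
  · obtain ⟨m, hm⟩ := Nat.exists_eq_add_of_le hb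
    simp only [scaledTerm, show h + 4 - (b + 1) = m + 2 by omega,
      show h + 3 - (b + 1) = m + 1 by omega, show h + 2 - (b + 1) = m by omega,
      show h + 1 - b = m by omega, weightedChoose_add_two m b (by omega)]
    ring
  · rw [scaledTerm_eq_zero, scaledTerm_eq_zero, scaledTerm_eq_zero, scaledTerm_eq_zero]
      <;> omega

lemma scaledTerm_zero (h : ℕ) : scaledTerm h 0 = (-3) ^ h * 2 := by
  simp [scaledTerm, weightedChoose]

/-- The whole sum, cleared of denominators. -/
def scaledSum (h : ℕ) : ℤ := ∑ b ∈ Finset.range (h / 3 + 1), scaledTerm h b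

lemma scaledSum_eq_sum_range {h n : ℕ} (hn : h / 3 < n) :
    scaledSum h = ∑ b ∈ Finset.range n, scaledTerm h b := by
  refine Finset.sum_subset (Finset.range_subset_range.2 hn) fun b _ hb ↦ ?_
  rw [Finset.mem_range] at hb
  exact scaledTerm_eq_zero (by omega) (by omega)

lemma scaledSum_add_four (h : ℕ) :
    scaledSum (h + 4) =
      -6 * scaledSum (h + 3) - 9 * scaledSum (h + 2) + 18 * scaledSum (h + 1) := by
  rw [scaledSum_eq_sum_range (n := h + 4 + 1) (by omega),
    scaledSum_eq_sum_range (h := h + 3) (n := h + 4 + 1) (by omega),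
    scaledSum_eq_sum_range (h := h + 2) (n := h + 4 + 1) (by omega),
    scaledSum_eq_sum_range (h := h + 1) (n := h + 4) (by omega)]
  simp only [Finset.sum_range_succ' _ (h + 4), scaledTerm_add_four, scaledTerm_zero,
    Finset.sum_add_distrib, Finset.sum_sub_distrib, ← Finset.mul_sum]
  ring

lemma scaledSum_one : scaledSum 1 = -6 := by decide

lemma scaledSum_two : scaledSum 2 = 18 := by decide

lemma scaledSum_three : scaledSum 3 = 0 := by decide

lemma scaledSum_emod (k : ℕ) :
    scaledSum (2 * k + 3) % 4 = 0 ∧ scaledSum (2 * k + 4) % 4 = 2 ∧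
      scaledSum (2 * k + 5) % 16 = 8 := by
  induction k with
  | zero =>
    have h4 := scaledSum_add_four 0
    have h5 := scaledSum_add_four 1
    norm_num [scaledSum_one, scaledSum_two, scaledSum_three] at h4 h5 ⊢
    rw [h4] at h5
    rw [h4, h5]
    norm_num
  | succ k ih =>
    have h6 := scaledSum_add_four (2 * k + 2)
    have h7 := scaledSum_add_four (2 * k + 3)
    simp only [mul_add, mul_one, add_assoc, Nat.reduceAdd] at h6 h7 ⊢
    omega

lemma scaledSum_ne_zero {h : ℕ} (h1 : 1 ≤ h) (h3 : h ≠ 3) : scaledSum h ≠ 0 := by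
  rcases lt_or_ge h 4 with hh | hh
  · interval_cases h
    · simp [scaledSum_one]
    · simp [scaledSum_two]
    · exact absurd rfl h3
  · have := scaledSum_emod ((h - 4) / 2)
    rcases Nat.even_or_odd' h with ⟨k, rfl | rfl⟩
    · rw [show 2 * ((2 * k - 4) / 2) + 4 = 2 * k by omega] at this
      omega
    · rw [show 2 * ((2 * k + 1 - 4) / 2) + 5 = 2 * k + 1 by omega] at this
      omega

lemma cast_scaledTerm {h b : ℕ} (hb : b < h) :
    (scaledTerm h b : ℚ) =
      2 * h * 3 ^ h *
        ((-1 : ℚ) ^ (h - b) / (h - b : ℕ) * ((h - b).choose (2 * b)) * (2 / 3) ^ b) := by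
  obtain ⟨m, rfl⟩ := Nat.exists_eq_add_of_le hb.le
  have hm : (m : ℚ) ≠ 0 := by
    norm_cast
    omega
  have key : (m : ℚ) * weightedChoose m b = 2 * (m + b) * m.choose (2 * b) := by
    exact_mod_cast mul_weightedChoose m b
  simp only [scaledTerm, Nat.add_sub_cancel_left]
  push_cast
  rw [neg_pow, div_pow, pow_add]
  field_simp
  linear_combination key

/-- For every integer `h ≥ 1` with `h ≠ 3`, the rational number
`∑_{b=0}^{⌊h/3⌋} ((−1)^{h−b}/(h−b)) · C(h−b, 2b) · (2/3)^b` is non-zero. -/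
theorem stmt19 (h : ℕ) (h1 : 1 ≤ h) (h3 : h ≠ 3) :
    ∑ b ∈ Finset.range (h / 3 + 1),
      ((-1 : ℚ) ^ (h - b) / (h - b : ℕ)) * ((h - b).choose (2 * b)) * (2 / 3) ^ b ≠ 0 := by
  intro hs
  refine scaledSum_ne_zero h1 h3 ?_
  have key : (scaledSum h : ℚ) = 0 := by
    rw [scaledSum, Int.cast_sum, Finset.sum_congr rfl fun b hb ↦ cast_scaledTerm
      (by rw [Finset.mem_range] at hb; omega), ← Finset.mul_sum, hs, mul_zero]
  exact_mod_cast key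
end
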